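/- arXiv:2008.02845 — 5 statements merged into one kernel-verified Lean document; each statement's English description precedes it below -/
import Mathlib

section
/- Let k be a field of characteristic zero and let A be the polynomial algebra over k in countably many variables e_n indexed by n ∈ ℤ together with one additional variable z (the symmetric algebra of the Virasoro algebra), equipped with a bracket {-,-} : A × A → A that is k-bilinear, antisymmetric, satisfies the Jacobi identity, is a derivation in each argument, and satisfies {e_n, e_m} = (m − n)·e_{n+m} + ((n³ − n)/12)·δ_{n+m,0}·z and {e_n, z} = 0 for all n, m ∈ ℤ. Then A satisfies the ACC on radical Poisson ideals. -/
/-- `B` is a Poisson bracket on the commutative `k`-algebra `A`: it is `k`-bilinear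
(additivity and `k`-homogeneity in the first argument, together with antisymmetry, give
bilinearity), antisymmetric, satisfies the Jacobi identity, and is a derivation in each
argument. -/
def IsPoissonBracket (k : Type*) {A : Type*} [CommRing k] [CommRing A] [Algebra k A]
    (B : A → A → A) : Prop :=
  (∀ a b c : A, B (a + b) c = B a c + B b c) ∧
  (∀ (r : k) (a b : A), B (r • a) b = r • B a b) ∧
  (∀ a b : A, B a b = - B b a) ∧
  (∀ a b c : A, B a (B b c) + B b (B c a) + B c (B a b) = 0) ∧
  (∀ a b c : A, B a (b * c) = B a b * c + b * B a c)

/-- An ideal `I` is a Poisson ideal for the bracket `B` if `{A, I} ⊆ I`. -/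
def IsPoissonIdeal {A : Type*} [CommRing A] (B : A → A → A) (I : Ideal A) : Prop :=
  ∀ x : A, ∀ y ∈ I, B x y ∈ I

/-- `A` satisfies the ascending chain condition on radical Poisson ideals. -/
def PoissonRadicalACC {A : Type*} [CommRing A] (B : A → A → A) : Prop :=
  ∀ c : ℕ → Ideal A, (∀ n, IsPoissonIdeal B (c n)) → (∀ n, (c n).IsRadical) →
    Monotone c → ∃ N, ∀ n, N ≤ n → c n = c N

open MvPolynomial

namespace VirPoisson

section General

variable {A : Type*} [CommRing A]

/-- Radical Poisson ideals. -/
def IsPR (B : A → A → A) (I : Ideal A) : Prop := IsPoissonIdeal B I ∧ I.IsRadical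

/-- The radical Poisson ideal generated by a set. -/
def cl (B : A → A → A) (S : Set A) : Ideal A := sInf {I | IsPR B I ∧ S ⊆ I}

/-- Finite generation as a radical Poisson ideal. -/
def IsFG (B : A → A → A) (I : Ideal A) : Prop :=
  ∃ T : Finset A, (T : Set A) ⊆ I ∧ I ≤ cl B (T : Set A)

variable {B : A → A → A}

lemma cl_le {S : Set A} {I : Ideal A} (hI : IsPR B I) (h : S ⊆ I) : cl B S ≤ I :=
  sInf_le ⟨hI, h⟩

lemma mem_cl {S : Set A} {x : A} : x ∈ cl B S ↔ ∀ I, IsPR B I → S ⊆ I → x ∈ I := by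
  simp only [cl, Submodule.mem_sInf, Set.mem_ofPred_eq, and_imp]

lemma subset_cl (S : Set A) : S ⊆ cl B S := fun _ hx => mem_cl.2 fun _ _ h => h hx

lemma isPR_cl (S : Set A) : IsPR B (cl B S) := by
  refine ⟨fun x y hy => mem_cl.2 fun I hI h => hI.1 x y (mem_cl.1 hy I hI h), ?_⟩
  rintro x ⟨n, hx⟩
  exact mem_cl.2 fun I hI h => hI.2 ⟨n, mem_cl.1 hx I hI h⟩

lemma cl_mono {S T : Set A} (h : S ⊆ T) : cl B S ≤ cl B T :=
  cl_le (isPR_cl T) (h.trans (subset_cl T))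

lemma isPR_sSup {c : Set (Ideal A)} (hc : ∀ I ∈ c, IsPR B I) (hne : c.Nonempty)
    (hd : DirectedOn (· ≤ ·) c) : IsPR B (sSup c) := by
  refine ⟨fun x y hy => ?_, ?_⟩
  · obtain ⟨I, hI, hyI⟩ := (Submodule.mem_sSup_of_directed hne hd).1 hy
    exact (Submodule.mem_sSup_of_directed hne hd).2 ⟨I, hI, (hc I hI).1 x y hyI⟩
  · rintro x ⟨n, hx⟩
    obtain ⟨I, hI, hyI⟩ := (Submodule.mem_sSup_of_directed hne hd).1 hx
    exact (Submodule.mem_sSup_of_directed hne hd).2 ⟨I, hI, (hc I hI).2 ⟨n, hyI⟩⟩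

lemma finset_subset_mem {c : Set (Ideal A)} (hne : c.Nonempty)
    (hd : DirectedOn (· ≤ ·) c) (T : Finset A) (hT : (T : Set A) ⊆ (sSup c : Ideal A)) :
    ∃ I ∈ c, (T : Set A) ⊆ I := by
  classical
  induction T using Finset.induction_on with
  | empty => obtain ⟨I, hI⟩ := hne; exact ⟨I, hI, by simp⟩
  | insert a s _ ih =>
    rw [Finset.coe_insert, Set.insert_subset_iff] at hT
    obtain ⟨I, hI, hs⟩ := ih hT.2
    obtain ⟨I', hI', ha⟩ := (Submodule.mem_sSup_of_directed hne hd).1 hT.1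
    obtain ⟨K, hK, h1, h2⟩ := hd I hI I' hI'
    refine ⟨K, hK, ?_⟩
    rw [Finset.coe_insert, Set.insert_subset_iff]
    exact ⟨h2 ha, hs.trans h1⟩

lemma cl_compact {S : Set A} {x : A} (hx : x ∈ cl B S) :
    ∃ T : Finset A, (T : Set A) ⊆ S ∧ x ∈ cl B (T : Set A) := by
  classical
  let c : Set (Ideal A) := {I | ∃ T : Finset A, (T : Set A) ⊆ S ∧ I = cl B (T : Set A)}
  have hne : c.Nonempty := ⟨_, ∅, by simp, rfl⟩
  have hd : DirectedOn (· ≤ ·) c := by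
    rintro _ ⟨T, hT, rfl⟩ _ ⟨T', hT', rfl⟩
    refine ⟨_, ⟨T ∪ T', by simp [hT, hT'], rfl⟩, cl_mono ?_, cl_mono ?_⟩ <;> simp
  have hpr : IsPR B (sSup c) := isPR_sSup (by rintro _ ⟨T, hT, rfl⟩; exact isPR_cl _) hne hd
  have hS : S ⊆ (sSup c : Ideal A) := fun s hs =>
    (Submodule.mem_sSup_of_directed hne hd).2
      ⟨_, ⟨{s}, by simpa using hs, rfl⟩, subset_cl _ (by simp)⟩
  obtain ⟨_, ⟨T, hT, rfl⟩, h⟩ := (Submodule.mem_sSup_of_directed hne hd).1 (cl_le hpr hS hx)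
  exact ⟨T, hT, h⟩

lemma cl_compact' {S : Set A} (F : Finset A) (hF : (F : Set A) ⊆ cl B S) :
    ∃ T : Finset A, (T : Set A) ⊆ S ∧ (F : Set A) ⊆ cl B (T : Set A) := by
  classical
  induction F using Finset.induction_on with
  | empty => exact ⟨∅, by simp, by simp⟩
  | insert a s _ ih =>
    rw [Finset.coe_insert, Set.insert_subset_iff] at hF
    obtain ⟨T, hT, hs⟩ := ih hF.2
    obtain ⟨T', hT', ha⟩ := cl_compact hF.1
    refine ⟨T ∪ T', by simp [hT, hT'], ?_⟩
    rw [Finset.coe_insert, Set.insert_subset_iff]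
    exact ⟨cl_mono (by simp) ha, hs.trans (cl_mono (B := B) (by simp))⟩

lemma fg_insert {P : Ideal A} {a : A} (h : IsFG B (cl B (insert a (P : Set A)))) :
    ∃ T : Finset A, (T : Set A) ⊆ P ∧ (P : Set A) ⊆ cl B (insert a (T : Set A)) := by
  classical
  obtain ⟨F, hF, hle⟩ := h
  obtain ⟨T, hT, hFT⟩ := cl_compact' F hF
  refine ⟨T.filter (· ∈ P), fun x hx => by simpa using (Finset.mem_filter.1 hx).2, ?_⟩
  intro p hp
  have h1 : p ∈ cl B (T : Set A) :=
    cl_le (isPR_cl _) hFT (hle (subset_cl _ (Set.mem_insert_of_mem _ hp)))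
  refine cl_mono ?_ h1
  intro x hx
  rcases hT hx with rfl | h
  · simp
  · right; simp only [Finset.coe_filter, Set.mem_ofPred_eq]; exact ⟨hx, h⟩

/-- Colon ideals of radical Poisson ideals by elements. -/
def colon (J : Ideal A) (b : A) : Ideal A where
  carrier := {x | x * b ∈ J}
  add_mem' := by
    intro x y hx hy
    simp only [Set.mem_ofPred_eq] at *
    rw [add_mul]; exact J.add_mem hx hy
  zero_mem' := by simp
  smul_mem' := by
    intro c x hx
    simp only [Set.mem_ofPred_eq, smul_eq_mul] at *
    rw [mul_assoc]; exact J.mul_mem_left _ hx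

lemma mem_colon {J : Ideal A} {b x : A} : x ∈ colon J b ↔ x * b ∈ J := Iff.rfl

lemma isPR_colon (hmul : ∀ a b c : A, B a (b * c) = B a b * c + b * B a c)
    {J : Ideal A} (hJ : IsPR B J) (b : A) : IsPR B (colon J b) := by
  refine ⟨fun x y hy => ?_, ?_⟩
  · rw [mem_colon] at *
    refine hJ.2 ⟨2, ?_⟩
    have h1 := hJ.1 x _ hy
    rw [hmul] at h1
    have : (B x y * b) ^ 2 = (B x y * b) * (B x y * b + y * B x b)
        - (B x y * B x b) * (y * b) := by ring
    rw [this]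
    exact J.sub_mem (J.mul_mem_left _ h1) (J.mul_mem_left _ hy)
  · rintro x ⟨n, hx⟩
    rw [mem_colon] at *
    refine hJ.2 ⟨n + 1, ?_⟩
    have : (x * b) ^ (n + 1) = (x * b ^ n) * (x ^ n * b) := by ring
    rw [this]
    exact J.mul_mem_left _ hx

lemma sq_mem {J : Ideal A} (hJ : IsPR B J) {x : A} (h : x * x ∈ J) : x ∈ J :=
  hJ.2 ⟨2, by rwa [pow_two]⟩

lemma isFG_of_key (hmul : ∀ a b c : A, B a (b * c) = B a b * c + b * B a c)
    (key : ∀ P : Ideal A, P.IsPrime → IsPoissonIdeal B P → ∃ F : Finset A, (F : Set A) ⊆ P ∧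
      ∃ H, H ∉ P ∧ ∀ p ∈ P, H * p ∈ cl B (F : Set A)) (I : Ideal A) (hI : IsPR B I) :
    IsFG B I := by
  classical
  by_contra hfg
  obtain ⟨P, -, hmax⟩ := zorn_le_nonempty₀ {I : Ideal A | IsPR B I ∧ ¬ IsFG B I} (by
    intro c hcS hc y hy
    have hne : c.Nonempty := ⟨y, hy⟩
    have hd := hc.directedOn
    refine ⟨sSup c, ⟨isPR_sSup (fun I hI => (hcS hI).1) hne hd, ?_⟩, fun z hz => le_sSup hz⟩
    rintro ⟨T, hT, hle⟩
    obtain ⟨I, hI, hTI⟩ := finset_subset_mem hne hd T hT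
    exact (hcS hI).2 ⟨T, hTI, (le_sSup hI).trans hle⟩) I ⟨hI, hfg⟩
  obtain ⟨⟨hPR, hPn⟩, hPmax⟩ := hmax
  have hext : ∀ a, a ∉ P → ∃ T : Finset A, (T : Set A) ⊆ P ∧
      (P : Set A) ⊆ cl B (insert a (T : Set A)) := by
    intro a ha
    apply fg_insert
    by_contra hcon
    have h1 := hPmax (y := cl B (insert a (P : Set A))) ⟨isPR_cl _, hcon⟩
      (fun p hp => subset_cl _ (Set.mem_insert_of_mem _ hp))
    exact ha (h1 (subset_cl _ (Set.mem_insert _ _)))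
  have hprime : P.IsPrime := by
    refine ⟨?_, ?_⟩
    · rintro rfl
      refine hPn ⟨{1}, by simp, ?_⟩
      rw [top_le_iff, Ideal.eq_top_iff_one]
      exact subset_cl _ (by simp)
    · intro a b hab
      by_contra! hcon
      obtain ⟨Ta, hTa, hPa⟩ := hext a hcon.1
      obtain ⟨Tb, hTb, hPb⟩ := hext b hcon.2
      refine hPn ⟨Ta ∪ Tb ∪ {a * b}, ?_, ?_⟩
      · simp only [Finset.coe_union, Finset.coe_singleton, Set.union_subset_iff,
          Set.singleton_subset_iff]
        exact ⟨⟨hTa, hTb⟩, hab⟩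
      · set J := cl B ((Ta ∪ Tb ∪ {a * b} : Finset A) : Set A) with hJ
        have hJPR : IsPR B J := isPR_cl _
        have hsub : ((Ta ∪ Tb ∪ {a * b} : Finset A) : Set A) ⊆ J := subset_cl _
        have h1 : ∀ p ∈ P, p * b ∈ J := by
          intro p hp
          refine cl_le (isPR_colon hmul hJPR b) ?_ (hPa hp)
          rw [Set.insert_subset_iff]
          refine ⟨hsub (by simp), fun t ht => ?_⟩
          exact J.mul_mem_right _ (hsub (by simp [Finset.mem_coe.1 ht]))
        intro p hp
        apply sq_mem hJPR
        refine cl_le (isPR_colon hmul hJPR p) ?_ (hPb hp)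
        rw [Set.insert_subset_iff]
        refine ⟨by rw [SetLike.mem_coe, mem_colon, mul_comm]; exact h1 p hp, fun t ht => ?_⟩
        exact J.mul_mem_right _ (hsub (by simp [Finset.mem_coe.1 ht]))
  obtain ⟨F, hF, H, hH, hHP⟩ := key P hprime hPR.1
  obtain ⟨T, hT, hPT⟩ := hext H hH
  refine hPn ⟨F ∪ T, by simp [hF, hT], ?_⟩
  intro p hp
  have hJPR : IsPR B (cl B ((F ∪ T : Finset A) : Set A)) := isPR_cl _
  apply sq_mem hJPR
  refine cl_le (isPR_colon hmul hJPR p) ?_ (hPT hp)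
  rw [Set.insert_subset_iff]
  refine ⟨cl_mono (by simp) (hHP p hp), fun t ht => ?_⟩
  exact Ideal.mul_mem_right _ _ (subset_cl _ (by simp [Finset.mem_coe.1 ht]))

lemma acc_of_key (hmul : ∀ a b c : A, B a (b * c) = B a b * c + b * B a c)
    (key : ∀ P : Ideal A, P.IsPrime → IsPoissonIdeal B P → ∃ F : Finset A, (F : Set A) ⊆ P ∧
      ∃ H, H ∉ P ∧ ∀ p ∈ P, H * p ∈ cl B (F : Set A)) : PoissonRadicalACC B := by
  intro c hc hr hm
  have hne : (Set.range c).Nonempty := Set.range_nonempty c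
  have hd : DirectedOn (· ≤ ·) (Set.range c) := by
    rintro _ ⟨i, rfl⟩ _ ⟨j, rfl⟩
    exact ⟨_, ⟨max i j, rfl⟩, hm (le_max_left _ _), hm (le_max_right _ _)⟩
  have hPR : ∀ I ∈ Set.range c, IsPR B I := by rintro _ ⟨i, rfl⟩; exact ⟨hc i, hr i⟩
  obtain ⟨T, hT, hle⟩ := isFG_of_key hmul key _ (isPR_sSup hPR hne hd)
  obtain ⟨_, ⟨N, rfl⟩, hN⟩ := finset_subset_mem hne hd T hT
  refine ⟨N, fun n hn => le_antisymm ?_ (hm hn)⟩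
  exact (le_sSup (Set.mem_range_self n)).trans (hle.trans (cl_le ⟨hc N, hr N⟩ hN))

end General

section Deriv

/-- An ideal stable under all partial derivatives is generated by its constants. -/
lemma le_map_comap_of_pderiv {k R σ : Type*} [Field k] [CharZero k] [CommRing R] [Algebra k R]
    (P : Ideal (MvPolynomial σ R)) (hP : ∀ f ∈ P, ∀ i, pderiv i f ∈ P) :
    P ≤ (P.comap (C : R →+* MvPolynomial σ R)).map (C : R →+* MvPolynomial σ R) := by
  have key : ∀ n : ℕ, ∀ f ∈ P, (∀ m : σ →₀ ℕ, n ≤ m.degree → coeff m f = 0) →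
      f ∈ (P.comap (C : R →+* MvPolynomial σ R)).map (C : R →+* MvPolynomial σ R) := by
    intro n
    induction n with
    | zero =>
      intro f _ h
      have : f = 0 := by ext m; simpa using h m (Nat.zero_le _)
      rw [this]; exact Ideal.zero_mem _
    | succ n ih =>
      intro f hf h
      have hco : ∀ m : σ →₀ ℕ, m ≠ 0 → coeff m f ∈ P.comap (C : R →+* MvPolynomial σ R) := by
        classical
        intro m hm
        obtain ⟨i, hi⟩ := Finsupp.ne_iff.1 hm
        have h1 := ih (pderiv i f) (hP f hf i) (by
          intro m' hm'
          rw [coeff_pderiv, h, zero_mul]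
          rw [map_add, Finsupp.degree_single]
          omega)
        rw [mem_map_C_iff] at h1
        have h2 := h1 (m - Finsupp.single i 1)
        have hle : Finsupp.single i 1 ≤ m := by
          rw [Finsupp.single_le_iff]
          exact Nat.one_le_iff_ne_zero.2 hi
        rw [coeff_pderiv, tsub_add_cancel_of_le hle] at h2
        obtain ⟨d, hd⟩ : ∃ d : ℕ, ((m - Finsupp.single i 1 : σ →₀ ℕ) i) = d := ⟨_, rfl⟩
        rw [hd] at h2
        have hu : ((d : R) + 1) * algebraMap k R (((d : k) + 1)⁻¹) = 1 := by
          have h3 : ((d : R) + 1) = algebraMap k R ((d : k) + 1) := by simp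
          rw [h3, ← map_mul, mul_inv_cancel₀ (by exact_mod_cast Nat.succ_ne_zero d), map_one]
        have h4 := Ideal.mul_mem_right (algebraMap k R (((d : k) + 1)⁻¹)) _ h2
        rwa [mul_assoc, hu, mul_one] at h4
      rw [mem_map_C_iff]
      intro m
      by_cases hm : m = 0
      · subst hm
        have hsub : f - C (coeff 0 f) ∈
            (P.comap (C : R →+* MvPolynomial σ R)).map (C : R →+* MvPolynomial σ R) := by
          classical
          rw [mem_map_C_iff]
          intro m
          by_cases hm : m = 0
          · subst hm; simp
          · rw [coeff_sub, coeff_C, if_neg (Ne.symm hm), sub_zero]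
            exact hco m hm
        have h5 : f - C (coeff 0 f) ∈ P := Ideal.map_comap_le hsub
        rw [Ideal.mem_comap]
        have := P.sub_mem hf h5
        simpa using this
      · exact hco m hm
  intro f hf
  refine key (f.totalDegree + 1) f hf ?_
  intro m hm
  apply coeff_eq_zero_of_totalDegree_lt
  have : m.degree = ∑ i ∈ m.support, m i := rfl
  omega

lemma optionEquivRight_pderiv {k : Type*} [Field k] (i : ℤ) (f : MvPolynomial (Option ℤ) k) :
    optionEquivRight k ℤ (pderiv (some i) f) = pderiv i (optionEquivRight k ℤ f) := by
  classical
  induction f using MvPolynomial.induction_on with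
  | C a => simp
  | add p q hp hq => rw [map_add, map_add, map_add, map_add, hp, hq]
  | mul_X p j hp =>
    rw [pderiv_mul, map_add, map_mul, map_mul, map_mul, pderiv_mul, hp]
    cases j with
    | none => simp
    | some j =>
      by_cases hij : j = i
      · subst hij; simp
      · rw [pderiv_X_of_ne (by simpa using hij), optionEquivRight_X_some, pderiv_X_of_ne hij]
        simp

lemma fg_of_pderiv {k : Type*} [Field k] [CharZero k] (P : Ideal (MvPolynomial (Option ℤ) k))
    (hP : ∀ f ∈ P, ∀ i : ℤ, pderiv (some i) f ∈ P) : P.FG := by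
  let φ := (optionEquivRight k ℤ).toRingEquiv
  let P' : Ideal (MvPolynomial ℤ (Polynomial k)) := P.comap φ.symm
  have h1 : ∀ f ∈ P', ∀ i, pderiv i f ∈ P' := by
    intro f hf i
    have h2 := hP _ hf i
    change φ.symm (pderiv i f) ∈ P
    have : φ.symm (pderiv i f) = pderiv (some i) (φ.symm f) := by
      rw [RingEquiv.symm_apply_eq]
      have h3 := optionEquivRight_pderiv i (φ.symm f)
      have h4 : optionEquivRight k ℤ (φ.symm f) = f := φ.apply_symm_apply f
      rw [h4] at h3
      exact h3.symm
    rw [this]; exact h2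
  have h2 := le_antisymm (le_map_comap_of_pderiv (k := k) P' h1) Ideal.map_comap_le
  have h3 : P'.FG := by
    rw [h2]
    exact Ideal.FG.map (IsNoetherian.noetherian _) _
  have h4 : P = P'.map (φ.symm : MvPolynomial ℤ (Polynomial k) →+* MvPolynomial (Option ℤ) k) := by
    rw [show P' = P.comap (φ.symm : MvPolynomial ℤ (Polynomial k) →+* _) from rfl,
      Ideal.map_comap_of_surjective
        (φ.symm : MvPolynomial ℤ (Polynomial k) →+* MvPolynomial (Option ℤ) k) φ.symm.surjective]
  rw [h4]
  exact h3.map _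

lemma derivation_sum_apply {k R ι : Type*} [CommRing k] [CommRing R] [Algebra k R] (s : Finset ι)
    (D : ι → Derivation k R R) (x : R) : (∑ i ∈ s, D i) x = ∑ i ∈ s, D i x := by
  have h := map_sum (Derivation.coeFnAddMonoidHom (R := k) (A := R) (M := R)) D s
  have h2 := congrFun h x
  rw [Finset.sum_apply] at h2
  exact h2

lemma derivation_eq_sum {k σ : Type*} [Field k] (D : Derivation k (MvPolynomial σ k)
    (MvPolynomial σ k)) (f : MvPolynomial σ k) :
    D f = ∑ i ∈ f.vars, pderiv i f * D (X i) := by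
  classical
  have : D f = (∑ i ∈ f.vars, D (X i) • pderiv i : Derivation k (MvPolynomial σ k)
      (MvPolynomial σ k)) f := by
    apply derivation_eq_of_forall_mem_vars
    intro i hi
    rw [derivation_sum_apply, Finset.sum_eq_single i]
    · simp
    · intro b _ hb
      simp [pderiv_X_of_ne (Ne.symm hb)]
    · exact fun h => absurd hi h
  rw [this, derivation_sum_apply]
  refine Finset.sum_congr rfl fun i _ => ?_
  simp [mul_comm]

end Deriv

section Virasoro

lemma pderiv_mem_supported {k σ : Type*} [Field k] {s : Set σ} {f : MvPolynomial σ k}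
    (hf : f ∈ supported k s) (i : σ) : pderiv i f ∈ supported k s := by
  classical
  induction hf using Algebra.adjoin_induction with
  | mem x hx =>
    obtain ⟨j, _, rfl⟩ := hx
    rw [pderiv_X, Pi.single_apply]
    split_ifs
    · exact one_mem _
    · exact zero_mem _
  | algebraMap r =>
    rw [MvPolynomial.algebraMap_eq, pderiv_C]; exact zero_mem _
  | add x y _ _ hx hy => rw [map_add]; exact add_mem hx hy
  | mul x y hx' hy' hx hy =>
    rw [pderiv_mul]; exact add_mem (mul_mem hx hy') (mul_mem hx' hy)

/-- The elements which lie in `S + J` after multiplication by a power of `H`. -/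
def locAlg {k A : Type*} [Field k] [CommRing A] [Algebra k A] (S : Subalgebra k A) (J : Ideal A)
    (H : A) (hH : H ∈ S) : Subalgebra k A where
  carrier := {a | ∃ r : ℕ, ∃ b ∈ S, H ^ r * a - b ∈ J}
  mul_mem' := by
    rintro a a' ⟨r, b, hb, h⟩ ⟨r', b', hb', h'⟩
    refine ⟨r + r', b * b', mul_mem hb hb', ?_⟩
    have : H ^ (r + r') * (a * a') - b * b' =
        (H ^ r' * a') * (H ^ r * a - b) + b * (H ^ r' * a' - b') := by ring
    rw [this]
    exact J.add_mem (J.mul_mem_left _ h) (J.mul_mem_left _ h')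
  add_mem' := by
    rintro a a' ⟨r, b, hb, h⟩ ⟨r', b', hb', h'⟩
    refine ⟨r + r', H ^ r' * b + H ^ r * b',
      add_mem (mul_mem (pow_mem hH _) hb) (mul_mem (pow_mem hH _) hb'), ?_⟩
    have : H ^ (r + r') * (a + a') - (H ^ r' * b + H ^ r * b') =
        H ^ r' * (H ^ r * a - b) + H ^ r * (H ^ r' * a' - b') := by ring
    rw [this]
    exact J.add_mem (J.mul_mem_left _ h) (J.mul_mem_left _ h')
  algebraMap_mem' := fun c => ⟨0, algebraMap k A c, S.algebraMap_mem c, by simp⟩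

section locAlg

variable {k A : Type*} [Field k] [CommRing A] [Algebra k A] {S : Subalgebra k A} {J : Ideal A}
    {H : A} {hH : H ∈ S}

lemma mem_locAlg {a : A} : a ∈ locAlg S J H hH ↔ ∃ r : ℕ, ∃ b ∈ S, H ^ r * a - b ∈ J := Iff.rfl

lemma le_locAlg {a : A} (ha : a ∈ S) : a ∈ locAlg S J H hH :=
  mem_locAlg.2 ⟨0, a, ha, by simp⟩

lemma ideal_le_locAlg {a : A} (ha : a ∈ J) : a ∈ locAlg S J H hH :=
  mem_locAlg.2 ⟨0, 0, zero_mem _, by simpa using ha⟩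

lemma mem_locAlg_of_mul {a : A} (ha : H * a ∈ locAlg S J H hH) : a ∈ locAlg S J H hH := by
  obtain ⟨r, b, hb, h⟩ := mem_locAlg.1 ha
  refine mem_locAlg.2 ⟨r + 1, b, hb, ?_⟩
  rwa [pow_succ, mul_assoc]

end locAlg

/-- The bracket as a derivation in its second argument. -/
noncomputable def brDer {k A : Type*} [Field k] [CommRing A] [Algebra k A] {B : A → A → A}
    (hB : IsPoissonBracket k B) (a : A) : Derivation k A A :=
  Derivation.mk'
    { toFun := B a
      map_add' := fun x y => by
        rw [hB.2.2.1 a, hB.1, neg_add, ← hB.2.2.1 a, ← hB.2.2.1 a]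
      map_smul' := fun r x => by
        rw [hB.2.2.1 a, hB.2.1, ← smul_neg, ← hB.2.2.1 a]; rfl }
    (fun x y => by
      change B a (x * y) = x • B a y + y • B a x
      rw [hB.2.2.2.2, smul_eq_mul, smul_eq_mul]; ring)

lemma brDer_apply {k A : Type*} [Field k] [CommRing A] [Algebra k A] {B : A → A → A}
    (hB : IsPoissonBracket k B) (a b : A) : brDer hB a b = B a b := rfl

/-- One elimination step. -/
lemma elim_step {k : Type*} [Field k] [CharZero k]
    {B : MvPolynomial (Option ℤ) k → MvPolynomial (Option ℤ) k → MvPolynomial (Option ℤ) k}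
    (hB : IsPoissonBracket k B)
    (hee : ∀ n m : ℤ,
      B (X (some n)) (X (some m)) =
        (m - n) • (X (some (n + m)) : MvPolynomial (Option ℤ) k) +
        (if n + m = 0 then (((n ^ 3 - n : ℤ) : k) / 12) • (X none : MvPolynomial (Option ℤ) k)
          else 0))
    (hez : ∀ n : ℤ, B (X (some n)) (X none) = 0)
    (S : Subalgebra k (MvPolynomial (Option ℤ) k)) (f : MvPolynomial (Option ℤ) k) (n M : ℤ)
    (hf : B (X (some n)) f ∈ S)
    (hM : some M ∈ f.vars) (h0 : ∀ m, some m ∈ f.vars → n + m ≠ 0) (hnM : M ≠ n)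
    (hS : ∀ m, some m ∈ f.vars → m ≠ M → pderiv (some m) f * X (some (n + m)) ∈ S) :
    pderiv (some M) f * X (some (n + M)) ∈ S := by
  classical
  have h1 := derivation_eq_sum (brDer hB (X (some n))) f
  simp only [brDer_apply] at h1
  rw [← Finset.add_sum_erase _ _ hM] at h1
  have h2 : ∀ m, some m ∈ f.vars → pderiv (some m) f * B (X (some n)) (X (some m)) =
      ((m - n : ℤ) : k) • (pderiv (some m) f * X (some (n + m))) := by
    intro m hm
    rw [hee, if_neg (h0 m hm), add_zero, mul_smul_comm, Int.cast_smul_eq_zsmul]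
  have h3 : ∑ o ∈ f.vars.erase (some M), pderiv o f * B (X (some n)) (X o) ∈ S := by
    refine sum_mem fun o ho => ?_
    rw [Finset.mem_erase] at ho
    cases o with
    | none => rw [hez, mul_zero]; exact zero_mem _
    | some m =>
      rw [h2 m ho.2]
      exact S.smul_mem (hS m ho.2 (by simpa using ho.1)) _
  rw [h2 M hM] at h1
  have h4 : ((M - n : ℤ) : k) • (pderiv (some M) f * X (some (n + M))) ∈ S := by
    rw [eq_sub_iff_add_eq.2 h1.symm]
    exact sub_mem hf h3
  have h5 : ((M - n : ℤ) : k) ≠ 0 := by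
    rw [Int.cast_ne_zero]; exact sub_ne_zero.2 hnM
  have h6 := S.smul_mem h4 (((M - n : ℤ) : k)⁻¹)
  rwa [smul_smul, inv_mul_cancel₀ h5, one_smul] at h6

lemma key_main {k : Type*} [Field k] [CharZero k]
    {B : MvPolynomial (Option ℤ) k → MvPolynomial (Option ℤ) k → MvPolynomial (Option ℤ) k}
    (hB : IsPoissonBracket k B)
    (hee : ∀ n m : ℤ,
      B (X (some n)) (X (some m)) =
        (m - n) • (X (some (n + m)) : MvPolynomial (Option ℤ) k) +
        (if n + m = 0 then (((n ^ 3 - n : ℤ) : k) / 12) • (X none : MvPolynomial (Option ℤ) k)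
          else 0))
    (hez : ∀ n : ℤ, B (X (some n)) (X none) = 0)
    (P : Ideal (MvPolynomial (Option ℤ) k)) (hP : P.IsPrime) (hPB : IsPoissonIdeal B P)
    (f : MvPolynomial (Option ℤ) k) (hf : f ∈ P) (i : ℤ) (hi : pderiv (some i) f ∉ P) :
    ∃ F : Finset (MvPolynomial (Option ℤ) k), (F : Set (MvPolynomial (Option ℤ) k)) ⊆ P ∧
      ∃ H, H ∉ P ∧ ∀ p ∈ P, H * p ∈ cl B (F : Set (MvPolynomial (Option ℤ) k)) := by
  classical
  -- the bound on the indices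
  obtain ⟨L, hL⟩ : ∃ L : ℕ, ∀ m : ℤ, some m ∈ f.vars → m.natAbs ≤ L :=
    ⟨f.vars.sup (fun o => o.elim 0 Int.natAbs), fun m hm =>
      Finset.le_sup (f := fun o : Option ℤ => o.elim 0 Int.natAbs) hm⟩
  let V : Set (Option ℤ) := {o | ∀ j : ℤ, o = some j → j.natAbs ≤ 2 * L}
  have hVfin : V.Finite := by
    refine Set.Finite.subset
      ((Set.finite_singleton none).union ((Set.finite_Icc (-(2 * L : ℤ)) (2 * L)).image some)) ?_
    intro o ho
    cases o with
    | none => left; rfl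
    | some j =>
      right
      have := ho j rfl
      refine ⟨j, ?_, rfl⟩
      rw [Set.mem_Icc]
      omega
  let S : Subalgebra k (MvPolynomial (Option ℤ) k) := supported k V
  have hXS : ∀ o ∈ V, (X o : MvPolynomial (Option ℤ) k) ∈ S := fun o ho =>
    Algebra.subset_adjoin ⟨o, ho, rfl⟩
  have hfS : f ∈ S := by
    refine mem_supported.2 fun o ho j hj => ?_
    subst hj
    have := hL j ho
    omega
  have hnoeth : IsNoetherianRing S := by
    have : Finite V := hVfin
    exact isNoetherianRing_of_ringEquiv (MvPolynomial V k)
      (supportedEquivMvPolynomial (R := k) V).symm.toRingEquiv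
  obtain ⟨F₀, hF₀⟩ : (P.comap S.val.toRingHom).FG := IsNoetherian.noetherian _
  let F : Finset (MvPolynomial (Option ℤ) k) := F₀.image S.val
  have hFP : (F : Set (MvPolynomial (Option ℤ) k)) ⊆ P := by
    intro x hx
    obtain ⟨y, hy, rfl⟩ := Finset.mem_image.1 (Finset.mem_coe.1 hx)
    have : y ∈ P.comap S.val.toRingHom := by rw [← hF₀]; exact Ideal.subset_span hy
    exact this
  set J := cl B (F : Set (MvPolynomial (Option ℤ) k)) with hJ
  have hJPR : IsPR B J := isPR_cl _
  have hPS : ∀ x ∈ P, x ∈ S → x ∈ J := by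
    intro x hx hxS
    have h1 : (⟨x, hxS⟩ : S) ∈ P.comap S.val.toRingHom := hx
    have h2 : P.comap S.val.toRingHom ≤ J.comap S.val.toRingHom := by
      rw [← hF₀, Ideal.span_le]
      intro y hy
      exact subset_cl (B := B) _ (Finset.mem_coe.2 (Finset.mem_image.2 ⟨y, hy, rfl⟩))
    exact h2 h1
  -- the leading and trailing separants
  let T : Finset ℤ := f.vars.eraseNone.filter (fun m => pderiv (some m) f ∉ P)
  have hTmem : ∀ m, m ∈ T ↔ some m ∈ f.vars ∧ pderiv (some m) f ∉ P := by
    intro m; simp [T, Finset.mem_eraseNone]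
  have hTne : T.Nonempty := by
    refine ⟨i, (hTmem i).2 ⟨?_, hi⟩⟩
    by_contra hcon
    rw [pderiv_eq_zero_of_notMem_vars hcon] at hi
    exact hi (zero_mem _)
  obtain ⟨M, hMT, hMmax⟩ : ∃ M ∈ T, ∀ m ∈ T, m ≤ M := ⟨T.max' hTne, T.max'_mem hTne, T.le_max'⟩
  obtain ⟨M', hMT', hMmin⟩ : ∃ M ∈ T, ∀ m ∈ T, M ≤ m :=
    ⟨T.min' hTne, T.min'_mem hTne, fun m hm => T.min'_le m hm⟩
  rw [hTmem] at hMT hMT'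
  let H := pderiv (some M) f * pderiv (some M') f
  have hdS : ∀ o, pderiv o f ∈ S := fun o => pderiv_mem_supported hfS o
  have hHS : H ∈ S := mul_mem (hdS _) (hdS _)
  have hHP : H ∉ P := fun h => (hP.mem_or_mem h).elim hMT.2 hMT'.2
  let Q := locAlg S J H hHS
  have hfJ : f ∈ J := hPS f hf hfS
  have hQ : ∀ d : ℕ, ∀ j : ℤ, j.natAbs = d → (X (some j) : MvPolynomial (Option ℤ) k) ∈ Q := by
    intro d
    induction d using Nat.strong_induction_on with
    | _ d ih =>
      intro j hj
      by_cases hjL : j.natAbs ≤ 2 * L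
      · refine le_locAlg (hXS _ ?_)
        intro j' hj'
        obtain rfl : j = j' := by simpa using hj'
        exact hjL
      have hstep : ∀ K : ℤ, some K ∈ f.vars →
          (∀ m ∈ T, m ≠ K → (j - K + m).natAbs < d) →
          pderiv (some K) f * X (some j) ∈ Q := by
        intro K hK hlt
        have hKL := hL K hK
        have := elim_step hB hee hez Q f (j - K) K (ideal_le_locAlg (hJPR.1 _ _ hfJ)) hK
          (by intro m hm; have := hL m hm; omega) (by omega) (by
            intro m hm hmK
            by_cases hmP : pderiv (some m) f ∈ P
            · exact ideal_le_locAlg (J.mul_mem_right _ (hPS _ hmP (hdS _)))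
            · exact mul_mem (le_locAlg (hdS _))
                (ih _ (hlt m ((hTmem m).2 ⟨hm, hmP⟩) hmK) _ rfl))
        rwa [sub_add_cancel] at this
      apply mem_locAlg_of_mul
      have hML := hL M hMT.1
      have hML' := hL M' hMT'.1
      rcases lt_or_ge 0 j with hpos | hneg
      · have h1 := hstep M hMT.1 (by
          intro m hm hmM
          have h2 := hMmax m hm
          have h3 := hL m ((hTmem m).1 hm).1
          omega)
        have h2 : H * X (some j) = pderiv (some M') f * (pderiv (some M) f * X (some j)) := by
          simp only [H]; ring
        rw [h2]
        exact mul_mem (le_locAlg (hdS _)) h1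
      · have h1 := hstep M' hMT'.1 (by
          intro m hm hmM
          have h2 := hMmin m hm
          have h3 := hL m ((hTmem m).1 hm).1
          omega)
        have h2 : H * X (some j) = pderiv (some M) f * (pderiv (some M') f * X (some j)) := by
          simp only [H]; ring
        rw [h2]
        exact mul_mem (le_locAlg (hdS _)) h1
  have hQtop : ∀ a, a ∈ Q := by
    have : (⊤ : Subalgebra k (MvPolynomial (Option ℤ) k)) ≤ Q := by
      rw [← MvPolynomial.adjoin_range_X, Algebra.adjoin_le_iff]
      rintro _ ⟨o, rfl⟩
      cases o with
      | none => exact le_locAlg (hXS _ (by intro j hj; simp at hj))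
      | some j => exact hQ _ j rfl
    exact fun a => this trivial
  refine ⟨F, hFP, H, hHP, fun p hp => ?_⟩
  obtain ⟨r, b, hb, h⟩ := mem_locAlg.1 (hQtop p)
  have hJP : J ≤ P := by
    exact cl_le ⟨hPB, hP.isRadical⟩ hFP
  have hbP : b ∈ P := by
    have := P.sub_mem (P.mul_mem_left (H ^ r) hp) (hJP h)
    simpa using this
  have h1 : H ^ r * p ∈ J := by
    have := J.add_mem h (hPS b hbP hb)
    simpa using this
  refine hJPR.2 ⟨r + 1, ?_⟩
  have h2 : (H * p) ^ (r + 1) = (H * p ^ r) * (H ^ r * p) := by ring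
  rw [h2]
  exact J.mul_mem_left _ h1

end Virasoro

end VirPoisson


/-- Let `k` be a field of characteristic zero and let `A` be the polynomial
algebra over `k` in variables `eₙ = X (some n)` for `n ∈ ℤ` together with one extra variable
`z = X none` (the symmetric algebra of the Virasoro algebra), endowed with its Poisson bracket
determined by `{eₙ, eₘ} = (m - n)·e_{n+m} + ((n³ - n)/12)·δ_{n+m,0}·z` and `{eₙ, z} = 0`.
Then `A` satisfies the ACC on radical Poisson ideals. -/
theorem symmetricAlgebraVirasoro_poissonRadicalACC
    {k : Type*} [Field k] [CharZero k]
    (B : MvPolynomial (Option ℤ) k → MvPolynomial (Option ℤ) k → MvPolynomial (Option ℤ) k)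
    (hB : IsPoissonBracket k B)
    (hee : ∀ n m : ℤ,
      B (X (some n)) (X (some m)) =
        (m - n) • (X (some (n + m)) : MvPolynomial (Option ℤ) k) +
        (if n + m = 0 then (((n ^ 3 - n : ℤ) : k) / 12) • (X none : MvPolynomial (Option ℤ) k)
          else 0))
    (hez : ∀ n : ℤ, B (X (some n)) (X none) = 0) :
    PoissonRadicalACC B := by
  refine VirPoisson.acc_of_key hB.2.2.2.2 ?_
  intro P hP hPB
  by_cases h : ∀ f ∈ P, ∀ i : ℤ, pderiv (some i) f ∈ P
  · obtain ⟨F, hF⟩ := VirPoisson.fg_of_pderiv P h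
    refine ⟨F, by rw [← hF]; exact Ideal.subset_span, 1, ?_, ?_⟩
    · exact fun h1 => hP.ne_top ((Ideal.eq_top_iff_one P).2 h1)
    · intro p hp
      rw [one_mul]
      rw [← hF] at hp
      exact Ideal.span_le.2 (VirPoisson.subset_cl (B := B) _) hp
  · push Not at h
    obtain ⟨f, hf, i, hi⟩ := h
    exact VirPoisson.key_main hB hee hez P hP hPB f hf i hi
end

section
/- Let k be an uncountable field and let A be a Poisson algebra over k whose underlying k-vector space has countable (i.e. at most countably infinite) dimension. Let P be a prime Poisson ideal of A. If P is Poisson-primitive, i.e. there exists a maximal ideal M of A with P ⊆ M such that every Poisson ideal of A contained in M is contained in P, then P is Poisson-rational: for all a, b ∈ A with b ∉ P, if b·{x, a} − a·{x, b} ∈ P for every x ∈ A, then there exist n ≥ 1 and scalars c₀, …, c_n ∈ k, not all zero, with Σ_{i=0}^{n} c_i·a^i·b^{n−i} ∈ P (equivalently, the Poisson centre of the fraction field of A/P is algebraic over k). -/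
/-- A prime Poisson ideal `P` is Poisson-primitive if it is the Poisson core of some maximal
ideal `M`, i.e. `P ⊆ M` and every Poisson ideal contained in `M` is contained in `P`. -/
def PoissonPrimitive {A : Type*} [CommRing A] (B : A → A → A) (P : Ideal A) : Prop :=
  ∃ M : Ideal A, M.IsMaximal ∧ P ≤ M ∧
    ∀ I : Ideal A, IsPoissonIdeal B I → I ≤ M → I ≤ P

/-- A prime Poisson ideal `P` is Poisson-rational if every Poisson-central element of
`Frac(A/P)` is algebraic over `k`: whenever `a, b ∈ A` with `b ∉ P` satisfy
`b·{x,a} − a·{x,b} ∈ P` for all `x`, there are `n ≥ 1` and scalars `c₀, …, cₙ ∈ k`, not all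
zero, with `∑ cᵢ aⁱ b^{n−i} ∈ P`. -/
def PoissonRational (k : Type*) {A : Type*} [CommRing k] [CommRing A] [Algebra k A]
    (B : A → A → A) (P : Ideal A) : Prop :=
  ∀ a b : A, b ∉ P → (∀ x : A, b * B x a - a * B x b ∈ P) →
    ∃ n : ℕ, 1 ≤ n ∧ ∃ c : ℕ → k, (∃ i : ℕ, i ≤ n ∧ c i ≠ 0) ∧
      (∑ i ∈ Finset.range (n + 1), c i • (a ^ i * b ^ (n - i))) ∈ P

/-- A prime Poisson ideal `P` is Poisson-locally closed if the intersection of all prime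
Poisson ideals strictly containing `P` strictly contains `P`. -/
def PoissonLocallyClosed {A : Type*} [CommRing A] (B : A → A → A) (P : Ideal A) : Prop :=
  P < sInf {Q : Ideal A | IsPoissonIdeal B Q ∧ Q.IsPrime ∧ P < Q}

/-- The underlying `k`-vector space of `A` has at most countable dimension. -/
def CountableDimension (k : Type*) (A : Type*) [CommRing k] [CommRing A] [Algebra k A] : Prop :=
  ∃ s : Set A, s.Countable ∧ Submodule.span k s = ⊤

theorem isAlgebraic_of_countable_span {k L : Type*} [Field k] [Uncountable k] [Field L]
    [Algebra k L] (s : Set L) (hs : s.Countable) (hspan : Submodule.span k s = ⊤) (z : L) :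
    IsAlgebraic k z := by
  by_contra hz
  have h1 := (Transcendental.linearIndependent_sub_inv (F := k) hz).cardinal_lift_le_rank
  have h2 : Module.rank k L ≤ Cardinal.aleph0 := by
    rw [← rank_top, ← hspan]
    exact (rank_span_le s).trans (Cardinal.mk_le_aleph0_iff.2 hs)
  have h3 := h1.trans (Cardinal.lift_le.2 h2)
  rw [Cardinal.lift_aleph0, Cardinal.lift_le_aleph0, Cardinal.mk_le_aleph0_iff] at h3
  exact not_countable (α := k) h3

/-- If `a/b` is Poisson-central in `Frac(A/P)` then `a/b` has a denominator outside `M`. -/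
theorem exists_denominator {k A : Type*} [Field k] [CommRing A] [Algebra k A]
    (B : A → A → A) (hB : IsPoissonBracket k B)
    (P : Ideal A) (hprime : P.IsPrime) (hpoisson : IsPoissonIdeal B P)
    (M : Ideal A) (hM : ∀ I : Ideal A, IsPoissonIdeal B I → I ≤ M → I ≤ P)
    (a b : A) (hb : b ∉ P) (hab : ∀ x : A, b * B x a - a * B x b ∈ P) :
    ∃ d e : A, d ∉ M ∧ d * a - b * e ∈ P := by
  obtain ⟨hadd, -, hanti, -, hmul⟩ := hB
  have hadd' : ∀ x u v, B x (u + v) = B x u + B x v := by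
    intro x u v
    rw [hanti, hadd, hanti u, hanti v]; ring
  have hsub' : ∀ x u v, B x (u - v) = B x u - B x v := by
    intro x u v
    have := hadd' x (u - v) v
    rw [sub_add_cancel] at this
    rw [this]; ring
  let I : Ideal A :=
    { carrier := {d | ∃ e, d * a - b * e ∈ P}
      add_mem' := by
        rintro u v ⟨e, he⟩ ⟨f, hf⟩
        refine ⟨e + f, ?_⟩
        convert P.add_mem he hf using 1; ring
      zero_mem' := ⟨0, by simp⟩
      smul_mem' := by
        rintro c u ⟨e, he⟩
        refine ⟨c * e, ?_⟩
        convert P.mul_mem_left c he using 1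
        simp only [smul_eq_mul]; ring }
  by_contra hcon
  push Not at hcon
  refine hb (hM I ?_ ?_ (show b ∈ I from ⟨a, by simp [mul_comm]⟩))
  · rintro x d ⟨e, he⟩
    refine ⟨B x e, ?_⟩
    have h1 := hpoisson x _ he
    rw [hsub', hmul, hmul] at h1
    refine (hprime.mem_or_mem (x := b) ?_).resolve_left hb
    have h2 := P.sub_mem (P.sub_mem (P.mul_mem_left b h1) (P.mul_mem_left d (hab x)))
      (P.mul_mem_left (B x b) he)
    convert h2 using 1
    ring
  · rintro d ⟨e, he⟩
    by_contra hd
    exact hcon d e hd he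

/-- Let `k` be an uncountable field and `A` a Poisson algebra over `k` of
countable vector space dimension.  Every Poisson-primitive prime Poisson ideal of `A` is
Poisson-rational. -/
theorem poissonRational_of_poissonPrimitive
    {k A : Type*} [Field k] [Uncountable k] [CommRing A] [Algebra k A]
    (hdim : CountableDimension k A)
    (B : A → A → A) (hB : IsPoissonBracket k B)
    (P : Ideal A) (hprime : P.IsPrime) (hpoisson : IsPoissonIdeal B P)
    (hprim : PoissonPrimitive B P) :
    PoissonRational k B P := by
  intro a b hb hab
  obtain ⟨M, hMmax, hPM, hM⟩ := hprim
  obtain ⟨d, e, hd, hde⟩ := exists_denominator B hB P hprime hpoisson M hM a b hb hab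
  have hdP : d ∉ P := fun h => hd (hPM h)
  have hB' := hB
  obtain ⟨hadd, hsmul, hanti, -, hmul⟩ := hB
  have hadd' : ∀ x u v, B x (u + v) = B x u + B x v := by
    intro x u v
    rw [hanti, hadd, hanti u, hanti v]; ring
  have hsub' : ∀ x u v, B x (u - v) = B x u - B x v := by
    intro x u v
    have := hadd' x (u - v) v
    rw [sub_add_cancel] at this
    rw [this]; ring
  have hsmul' : ∀ x (r : k) u, B x (r • u) = r • B x u := by
    intro x r u
    rw [hanti, hsmul, hanti u, smul_neg, neg_neg]
  -- `e/d` is central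
  have hed : ∀ x, d * B x e - e * B x d ∈ P := by
    intro x
    have h1 := hpoisson x _ hde
    rw [hsub', hmul, hmul] at h1
    refine (hprime.mem_or_mem (x := b * b) ?_).resolve_left
      (fun h => (hprime.mem_or_mem h).elim hb hb)
    have h2 := P.add_mem (P.sub_mem (P.mul_mem_left (d * d) (hab x))
      (P.mul_mem_left (b * d) h1)) (P.mul_mem_left (b * B x d + d * B x b) hde)
    convert h2 using 1
    ring
  -- weights
  let W : ℕ → A → Prop := fun n N => ∀ x, d * B x N - n * N * B x d ∈ P
  have W1 : ∀ x, B x 1 = 0 := by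
    intro x
    have := hmul x 1 1
    simpa using this
  have W0 : W 0 1 := by
    intro x; simp [W1]
  have Wmul : ∀ m n u v, W m u → W n v → W (m + n) (u * v) := by
    intro m n u v hu hv x
    convert P.add_mem (P.mul_mem_left v (hu x)) (P.mul_mem_left u (hv x)) using 1
    rw [hmul]; push_cast; ring
  have Wpow : ∀ u, W 1 u → ∀ n, W n (u ^ n) := by
    intro u hu n
    induction n with
    | zero => simpa using W0
    | succ n ih => rw [pow_succ]; exact Wmul _ _ _ _ ih hu
  have We : W 1 e := by intro x; simpa using hed x
  have Wd : W 1 d := by intro x; simp [mul_comm]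
  have Wadd : ∀ n u v, W n u → W n v → W n (u + v) := by
    intro n u v hu hv x
    convert P.add_mem (hu x) (hv x) using 1
    rw [hadd']; ring
  have Wsmul : ∀ n (r : k) u, W n u → W n (r • u) := by
    intro n r u hu x
    convert P.mul_mem_left (algebraMap k A r) (hu x) using 1
    rw [hsmul', Algebra.smul_def, Algebra.smul_def]; ring
  have Wzero : ∀ n, W n 0 := by
    intro n; simpa using Wsmul n 0 _ (Wpow d Wd n)
  have Wsum : ∀ n (s : Finset ℕ) (f : ℕ → A), (∀ i ∈ s, W n (f i)) → W n (∑ i ∈ s, f i) := by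
    intro n s f hf
    exact Finset.sum_induction f (W n) (Wadd n) (Wzero n) hf
  -- residue field
  letI : Field (A ⧸ M) := Ideal.Quotient.field M
  let π : A →ₐ[k] A ⧸ M := Ideal.Quotient.mkₐ k M
  have hπ : ∀ x, π x = 0 ↔ x ∈ M := fun x => Ideal.Quotient.eq_zero_iff_mem
  have halg : IsAlgebraic k (π e / π d) := by
    obtain ⟨s, hs, hspan⟩ := hdim
    refine isAlgebraic_of_countable_span (π '' s) (hs.image _) ?_ _
    have h := Submodule.span_image (s := s) π.toLinearMap
    rw [hspan, Submodule.map_top, LinearMap.range_eq_top.2] at h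
    · exact h
    · exact Ideal.Quotient.mkₐ_surjective k M
  have hint := halg.isIntegral
  set p := minpoly k (π e / π d) with hp
  have hpi : 0 < p.natDegree := minpoly.natDegree_pos hint
  refine ⟨p.natDegree, hpi, p.coeff, ⟨p.natDegree, le_rfl, ?_⟩, ?_⟩
  · have : p.coeff p.natDegree = 1 := (minpoly.monic hint).coeff_natDegree
    rw [this]; exact one_ne_zero
  have hev : Polynomial.aeval (π e / π d) p = 0 := minpoly.aeval k _
  generalize p.natDegree = n, hn : p.natDegree = n at *
  have hd0 : π d ≠ 0 := fun h => hd ((hπ d).1 h)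
  set w : A := ∑ i ∈ Finset.range (n + 1), p.coeff i • (e ^ i * d ^ (n - i)) with hw
  have hwM : w ∈ M := by
    rw [← hπ, hw, map_sum]
    rw [Polynomial.aeval_eq_sum_range, hn] at hev
    have := congrArg (fun t => (π d) ^ n * t) hev
    simp only [Finset.mul_sum, mul_zero] at this
    rw [← this]
    refine Finset.sum_congr rfl fun i hi => ?_
    have hi' : i ≤ n := Nat.lt_succ_iff.1 (Finset.mem_range.1 hi)
    rw [map_smul, map_mul, map_pow, map_pow, mul_smul_comm, div_pow]
    congr 1
    rw [pow_sub₀ _ hd0 hi']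
    field_simp
  have Ww : W n w := by
    refine Wsum n _ _ fun i hi => Wsmul n _ _ ?_
    have hi' : i ≤ n := Nat.lt_succ_iff.1 (Finset.mem_range.1 hi)
    have := Wmul _ _ _ _ (Wpow e We i) (Wpow d Wd (n - i))
    rwa [Nat.add_sub_cancel' hi'] at this
  have hwP : w ∈ P := by
    by_contra hwP
    obtain ⟨g, h, hg, hgh⟩ := exists_denominator B hB' P hprime hpoisson M hM (d ^ n) w hwP (by
      intro x
      refine (hprime.mem_or_mem (x := d) ?_).resolve_left hdP
      convert P.sub_mem (P.mul_mem_left w (Wpow d Wd n x)) (P.mul_mem_left (d ^ n) (Ww x)) using 1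
      ring)
    have h1 : g * d ^ n ∈ M := by
      have := M.add_mem (hPM hgh) (M.mul_mem_right h hwM)
      simpa using this
    exact (hMmax.isPrime.mem_or_mem h1).elim hg fun h => hd (hMmax.isPrime.mem_of_pow_mem n h)
  refine (hprime.mem_or_mem (x := d ^ n) ?_).resolve_left
    fun h => hdP (hprime.mem_of_pow_mem n h)
  have h1 := P.mul_mem_left (b ^ n) hwP
  rw [← Ideal.Quotient.eq_zero_iff_mem] at h1 ⊢
  rw [← h1]
  rw [← sub_mem_comm_iff, ← Ideal.Quotient.eq] at hde
  rw [hw, Finset.mul_sum, Finset.mul_sum, map_sum, map_sum]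
  refine Finset.sum_congr rfl fun i hi => ?_
  have hi' : i ≤ n := Nat.lt_succ_iff.1 (Finset.mem_range.1 hi)
  obtain ⟨j, rfl⟩ := Nat.exists_eq_add_of_le hi'
  have e1 : d ^ (i + j) * p.coeff i • (a ^ i * b ^ (i + j - i))
      = algebraMap k A (p.coeff i) * (d * a) ^ i * (d * b) ^ j := by
    rw [Algebra.smul_def, Nat.add_sub_cancel_left]; ring
  have e2 : b ^ (i + j) * p.coeff i • (e ^ i * d ^ (i + j - i))
      = algebraMap k A (p.coeff i) * (b * e) ^ i * (d * b) ^ j := by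
    rw [Algebra.smul_def, Nat.add_sub_cancel_left]; ring
  rw [e1, e2]
  simp only [map_mul _ (_ * _), map_pow] at *
  rw [map_mul _ _ (_ ^ i), map_mul _ _ (_ ^ i), map_pow, map_pow, hde]
end

section
/- Let k be an uncountable field and let A be a Poisson algebra over k whose underlying k-vector space has countable (i.e. at most countably infinite) dimension. Let P be a prime Poisson ideal of A. If P is Poisson-rational (for all a, b ∈ A with b ∉ P: if b·{x, a} − a·{x, b} ∈ P for every x ∈ A, then there exist n ≥ 1 and scalars c₀, …, c_n ∈ k, not all zero, with Σ_{i=0}^{n} c_i·a^i·b^{n−i} ∈ P), then P is Poisson-primitive: there exists a maximal ideal M of A with P ⊆ M such that every Poisson ideal of A contained in M is contained in P. -/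
theorem alg_of_countable {k : Type*} [Field k] [Uncountable k] {K : Type*} [Field K] [Algebra k K] (s : Set K) (hs : s.Countable)
    (h : Submodule.span k s = ⊤) : Algebra.IsAlgebraic k K := by
  refine ⟨fun x => ?_⟩
  by_contra hx
  have := Transcendental.linearIndependent_sub_inv (F := k) (E := K) hx
  have h1 := this.cardinal_lift_le_rank
  have h2 : Module.rank k K ≤ Cardinal.aleph0 := by
    rw [← rank_top, ← h]
    exact (rank_span_le s).trans (Cardinal.le_aleph0_iff_set_countable.2 hs)
  have h3 := h1.trans (Cardinal.lift_le.2 h2)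
  rw [Cardinal.lift_aleph0, Cardinal.lift_le_aleph0, Cardinal.mk_le_aleph0_iff] at h3
  exact not_countable h3

theorem algebraMap_smul_aux {k A : Type*} [Field k] [CommRing A] [Algebra k A]
    (S : Submonoid A) (r : k) (a : A) :
    algebraMap A (Localization S) (r • a) = r • algebraMap A (Localization S) a := by
  rw [Algebra.algebraMap_eq_smul_one, Algebra.algebraMap_eq_smul_one, smul_assoc]

theorem exists_maximal_avoiding {k A : Type*} [Field k] [Uncountable k] [CommRing A] [Algebra k A]
    (s : Set A) (hs : s.Countable) (hspan : Submodule.span k s = ⊤)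
    (P : Ideal A) (hprime : P.IsPrime) (X : Set A) (hX : X.Countable) (hXP : ∀ x ∈ X, x ∉ P) :
    ∃ M : Ideal A, M.IsMaximal ∧ P ≤ M ∧ ∀ x ∈ X, x ∉ M := by
  let S := Submonoid.closure X
  have hSP : Disjoint (S : Set A) (P : Set A) := by
    have : S ≤ P.primeCompl := (Submonoid.closure_le).2 hXP
    exact Set.disjoint_left.2 fun x hx hxP => this hx hxP
  have hSc : Countable S := by
    have : (S : Set A) ⊆ Set.range (fun m : Multiset X => (m.map Subtype.val).prod) := by
      intro x hx
      obtain ⟨m, hm, rfl⟩ := Submonoid.exists_multiset_of_mem_closure hx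
      lift m to Multiset X using hm
      exact ⟨m, rfl⟩
    have := hX.to_subtype
    have : Countable (Multiset X) := by infer_instance
    exact ((Set.countable_range _).mono ‹(S : Set A) ⊆ _›).to_subtype
  have hne : P.map (algebraMap A (Localization S)) ≠ ⊤ :=
    (IsLocalization.map_algebraMap_ne_top_iff_disjoint S (Localization S) P).2 hSP
  obtain ⟨N, hN, hPN⟩ := Ideal.exists_le_maximal _ hne
  let κ := Localization S ⧸ N
  let _ : Field κ := Ideal.Quotient.field N
  have hκ : Algebra.IsAlgebraic k κ := by
    have := hs.to_subtype
    apply alg_of_countable (Set.range fun p : s × S =>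
      (Ideal.Quotient.mk N (IsLocalization.mk' (Localization S) (p.1 : A) p.2) : κ))
      (Set.countable_range _)
    rw [eq_top_iff]
    rintro x -
    obtain ⟨y, rfl⟩ := Ideal.Quotient.mk_surjective x
    obtain ⟨⟨a, m⟩, rfl⟩ := IsLocalization.mk'_surjective S y
    have ha : a ∈ Submodule.span k s := by rw [hspan]; trivial
    dsimp only
    induction ha using Submodule.span_induction with
    | mem a ha => exact Submodule.subset_span ⟨(⟨a, ha⟩, m), rfl⟩
    | zero => simp
    | add a b _ _ ha hb =>
      have := Submodule.add_mem _ ha hb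
      convert this using 1
      rw [← map_add, IsLocalization.mk'_eq_mul_mk'_one (a + b), IsLocalization.mk'_eq_mul_mk'_one a,
        IsLocalization.mk'_eq_mul_mk'_one b, map_add, add_mul]
    | smul r a _ ha =>
      have := Submodule.smul_mem _ r ha
      convert this using 1
      rw [IsLocalization.mk'_eq_mul_mk'_one (r • a), IsLocalization.mk'_eq_mul_mk'_one a,
        algebraMap_smul_aux S r a, smul_mul_assoc]
      rfl
  have hint : Algebra.IsIntegral k κ := inferInstance
  have hint' : Algebra.IsIntegral A κ := Algebra.IsIntegral.tower_top (R := k)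
  refine ⟨Ideal.comap (algebraMap A κ) ⊥,
    Ideal.isMaximal_comap_of_isIntegral_of_isMaximal _, ?_, ?_⟩
  · intro p hp
    rw [Ideal.mem_comap, Ideal.mem_bot]
    exact Ideal.Quotient.eq_zero_iff_mem.2 (hPN (Ideal.mem_map_of_mem _ hp))
  · intro x hx hxM
    rw [Ideal.mem_comap, Ideal.mem_bot] at hxM
    have h1 : algebraMap A (Localization S) x ∈ N := Ideal.Quotient.eq_zero_iff_mem.1 hxM
    exact hN.ne_top (Ideal.eq_top_of_isUnit_mem _ h1
      (IsLocalization.map_units (Localization S) ⟨x, Submonoid.subset_closure hx⟩))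

/-- The Hamiltonian of `x`, as a `k`-linear map. -/
def adMap {k A : Type*} [Field k] [CommRing A] [Algebra k A]
    (B : A → A → A) (hB : IsPoissonBracket k B) (x : A) : A →ₗ[k] A where
  toFun := B x
  map_add' a b := by
    obtain ⟨h1, h2, h3, -⟩ := hB
    rw [h3 x (a + b), h1, h3 x a, h3 x b]; ring
  map_smul' r a := by
    obtain ⟨h1, h2, h3, -⟩ := hB
    rw [h3 x (r • a), h2, h3 x a]; simp

/-- Linear operators preserving every Poisson ideal. -/
def Pres {k A : Type*} [Field k] [CommRing A] [Algebra k A]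
    (B : A → A → A) (L : A →ₗ[k] A) : Prop :=
  ∀ I : Ideal A, IsPoissonIdeal B I → ∀ a ∈ I, L a ∈ I

/-- Separating operators for finite independent families. -/
theorem exists_operator {k A F ι : Type*} [Field k] [CommRing A] [Algebra k A] [Field F]
    (B : A → A → A) (f : A →+* F) 
    (hf : ∀ r : F, ∃ a b : A, f b ≠ 0 ∧ r * f b = f a)
    [Fintype ι] [DecidableEq ι] (e : ι → A)
    (he : LinearIndependent F
      (fun i => (fun L : {L : A →ₗ[k] A // Pres B L} => f (L.1 (e i)))))
    (j : ι) :
    ∃ L : A →ₗ[k] A, Pres B L ∧ f (L (e j)) ≠ 0 ∧ ∀ i, i ≠ j → f (L (e i)) = 0 := by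
  let p : Submodule F (ι → F) := Submodule.span F
    (Set.range fun (L : {L : A →ₗ[k] A // Pres B L}) (i : ι) => f (L.1 (e i)))
  have hp : p = ⊤ := by
    by_contra hne
    obtain ⟨g, hg0, hg⟩ := Submodule.exists_le_ker_of_lt_top p (lt_top_iff_ne_top.2 hne)
    apply hg0
    have key : ∀ i, g (Pi.single i 1) = 0 := by
      refine Fintype.linearIndependent_iff.1 he (fun i => g (Pi.single i 1)) ?_
      funext L
      have h1 : (fun i : ι => f (L.1 (e i))) ∈ LinearMap.ker g :=
        hg (Submodule.subset_span ⟨L, rfl⟩)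
      rw [LinearMap.mem_ker, pi_eq_sum_univ' (fun i : ι => f (L.1 (e i))), map_sum] at h1
      rw [Finset.sum_apply, Pi.zero_apply, ← h1]
      refine Finset.sum_congr rfl fun i _ => ?_
      have : (fun j => if j = i then (1 : F) else 0) = Pi.single i 1 := by
        funext j; simp [Pi.single_apply]
      simp [mul_comm]
    refine LinearMap.pi_ext' fun i => LinearMap.ext_ring ?_
    simpa using key i
  have main : ∀ y ∈ p, ∃ d : A, f d ≠ 0 ∧ ∃ L : A →ₗ[k] A, Pres B L ∧
      ∀ i, f (L (e i)) = f d * y i := by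
    intro y hy
    induction hy using Submodule.span_induction with
    | mem y hy =>
      obtain ⟨L, rfl⟩ := hy
      exact ⟨1, by simp, L.1, L.2, by simp⟩
    | zero => exact ⟨1, by simp, 0, fun I _ a _ => by simp, by simp⟩
    | add y z _ _ hy hz =>
      obtain ⟨d, hd, L, hL, h⟩ := hy
      obtain ⟨d', hd', L', hL', h'⟩ := hz
      refine ⟨d * d', by simp [hd, hd'], d' • L + d • L', ?_, ?_⟩
      · intro I hI a ha
        simp only [LinearMap.add_apply, LinearMap.smul_apply, smul_eq_mul]
        exact I.add_mem (I.mul_mem_left _ (hL I hI a ha)) (I.mul_mem_left _ (hL' I hI a ha))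
      · intro i
        simp only [LinearMap.add_apply, LinearMap.smul_apply, smul_eq_mul, map_add, map_mul, h, h',
          Pi.add_apply]
        ring
    | smul r y _ hy =>
      obtain ⟨d, hd, L, hL, h⟩ := hy
      obtain ⟨a, b, hb, hab⟩ := hf r
      refine ⟨b * d, by simp [hd, hb], a • L, ?_, ?_⟩
      · intro I hI x hx
        exact I.mul_mem_left _ (hL I hI x hx)
      · intro i
        simp only [LinearMap.smul_apply, smul_eq_mul, map_mul, h, Pi.smul_apply, ← hab]
        ring
  obtain ⟨d, hd, L, hL, h⟩ := main (Pi.single j 1) (by rw [hp]; trivial)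
  refine ⟨L, hL, by simpa [h] using hd, fun i hi => by simp [h, hi]⟩

theorem mem_of_algebraic {k A : Type*} [Field k] [CommRing A] [Algebra k A]
    (P M : Ideal A) (hP : P.IsPrime) (hM : M.IsPrime) (hPM : P ≤ M) (u w : A) (hu : u ∉ P)
    (huM : u ∈ M) (n : ℕ) (c : ℕ → k) (hc : ∃ i, i ≤ n ∧ c i ≠ 0)
    (h : (∑ i ∈ Finset.range (n + 1), c i • (u ^ i * w ^ (n - i))) ∈ P) : w ∈ M := by
  induction n generalizing c with
  | zero =>
    obtain ⟨i, hi, hci⟩ := hc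
    obtain rfl : i = 0 := by omega
    exfalso
    apply hP.ne_top
    rw [Ideal.eq_top_iff_one]
    have := (P.restrictScalars k).smul_mem (c 0)⁻¹ h
    simpa [smul_smul, hci] using this
  | succ n ih =>
    rw [Finset.sum_range_succ'] at h
    have e : ∑ i ∈ Finset.range (n + 1), c (i + 1) • (u ^ (i + 1) * w ^ (n + 1 - (i + 1)))
        = u * ∑ i ∈ Finset.range (n + 1), c (i + 1) • (u ^ i * w ^ (n - i)) := by
      rw [Finset.mul_sum]
      refine Finset.sum_congr rfl fun i _ => ?_
      rw [mul_smul_comm, Nat.add_sub_add_right]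
      congr 1; ring
    rw [e] at h
    by_cases h0 : c 0 = 0
    · rw [h0, zero_smul, add_zero] at h
      refine ih (fun i => c (i + 1)) ?_ ((hP.mem_or_mem h).resolve_left hu)
      obtain ⟨i, hi, hci⟩ := hc
      cases i with
      | zero => exact absurd h0 hci
      | succ i => exact ⟨i, by omega, hci⟩
    · have h1 := (M.add_mem_iff_right (M.mul_mem_right _ huM)).1 (hPM h)
      have := (M.restrictScalars k).smul_mem (c 0)⁻¹ h1
      have h2 : w ^ (n + 1) ∈ M := by simpa [smul_smul, h0] using this
      exact hM.mem_of_pow_mem _ h2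

/-- Let `k` be an uncountable field and `A` a Poisson algebra over `k` of
countable vector space dimension.  Every Poisson-rational prime Poisson ideal of `A` is
Poisson-primitive. -/
theorem poissonPrimitive_of_poissonRational
    {k A : Type*} [Field k] [Uncountable k] [CommRing A] [Algebra k A]
    (hdim : CountableDimension k A)
    (B : A → A → A) (hB : IsPoissonBracket k B)
    (P : Ideal A) (hprime : P.IsPrime) (hpoisson : IsPoissonIdeal B P)
    (hrat : PoissonRational k B P) :
    PoissonPrimitive B P := by
  obtain ⟨s, hs, hspan⟩ := hdim
  classical
  let F := FractionRing (A ⧸ P)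
  let f : A →+* F := (algebraMap (A ⧸ P) F).comp (Ideal.Quotient.mk P)
  have hf0 : ∀ a, f a = 0 ↔ a ∈ P := by
    intro a
    rw [← Ideal.Quotient.eq_zero_iff_mem]
    exact FaithfulSMul.algebraMap_eq_zero_iff (A ⧸ P) F
  have hfrac : ∀ r : F, ∃ a b : A, f b ≠ 0 ∧ r * f b = f a := by
    intro r
    obtain ⟨⟨x, y⟩, hxy⟩ := IsLocalization.surj (nonZeroDivisors (A ⧸ P)) r
    obtain ⟨a, rfl⟩ := Ideal.Quotient.mk_surjective x
    obtain ⟨b, hb⟩ := Ideal.Quotient.mk_surjective (y : A ⧸ P)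
    refine ⟨a, b, ?_, ?_⟩
    · rw [Ne, hf0, ← Ideal.Quotient.eq_zero_iff_mem, hb]
      exact nonZeroDivisors.ne_zero y.2
    · rw [← hb] at hxy
      exact hxy
  let φ : A → ({L : A →ₗ[k] A // Pres B L} → F) := fun a L => f (L.1 a)
  obtain ⟨b, hbs, -, hsb, hb⟩ := exists_linearIndepOn_extension (K := F) (v := φ)
    (linearIndepOn_empty F φ) (Set.empty_subset s)
  have hbc : Countable b := (hs.mono hbs).to_subtype
  have hφ : ∀ a : A, φ a ∈ Submodule.span F (Set.range fun i : b => φ i) := by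
    intro a
    have ha : a ∈ Submodule.span k s := by rw [hspan]; trivial
    have himg : (Set.range fun i : b => φ i) = φ '' b := by
      rw [Set.image_eq_range]
    rw [himg]
    induction ha using Submodule.span_induction with
    | mem a ha => exact hsb ⟨a, ha, rfl⟩
    | zero =>
      have : φ 0 = 0 := by funext L; simp [φ]
      rw [this]; exact Submodule.zero_mem _
    | add x y _ _ hx hy =>
      have : φ (x + y) = φ x + φ y := by funext L; simp [φ]
      rw [this]; exact Submodule.add_mem _ hx hy
    | smul r x _ hx =>
      have : φ (r • x) = f (algebraMap k A r) • φ x := by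
        funext L
        simp only [φ, map_smul, Pi.smul_apply, smul_eq_mul]
        rw [Algebra.smul_def, map_mul]
      rw [this]; exact Submodule.smul_mem _ _ hx
  have hop : ∀ q : Finset b × b, ∃ L : A →ₗ[k] A, Pres B L ∧ L q.2 ∉ P ∧
      ∀ i ∈ q.1, i ≠ q.2 → L i ∈ P := by
    rintro ⟨T, j⟩
    have hli : LinearIndependent F (fun i : (insert j T : Finset b) => φ i.1) :=
      LinearIndependent.comp hb (fun i : (insert j T : Finset b) => i.1) Subtype.val_injective
    obtain ⟨L, hL, h1, h2⟩ := exists_operator B f hfrac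
      (fun i : (insert j T : Finset b) => (i.1 : A)) hli ⟨j, Finset.mem_insert_self _ _⟩
    refine ⟨L, hL, fun h => h1 ((hf0 _).2 h), fun i hi hij => ?_⟩
    exact (hf0 _).1 (h2 ⟨i, Finset.mem_insert_of_mem hi⟩ (fun h => hij (congrArg Subtype.val h)))
  choose Λ hΛ hΛP hΛ0 using hop
  obtain ⟨M, hM, hPM, hXM⟩ := exists_maximal_avoiding s hs hspan P hprime
    (Set.range fun q : Finset b × b => Λ q q.2) (Set.countable_range _)
    (by rintro _ ⟨q, rfl⟩; exact hΛP q)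
  refine ⟨M, hM, hPM, fun I hI hIM v hv => ?_⟩
  by_contra hvP
  obtain ⟨c, hc⟩ := Finsupp.mem_span_range_iff_exists_finsupp.1 (hφ v)
  have hexp : ∀ L : A →ₗ[k] A, Pres B L → f (L v) = ∑ i ∈ c.support, c i * f (L i) := by
    intro L hL
    have := congrFun hc ⟨L, hL⟩
    simp only [Finsupp.sum, Finset.sum_apply, Pi.smul_apply, smul_eq_mul, φ] at this
    exact this.symm
  have hj : ∃ j, j ∈ c.support := by
    by_contra hno
    have h1 := hexp LinearMap.id (fun I _ a ha => ha)
    rw [Finset.sum_eq_zero (fun i hi => absurd ⟨i, hi⟩ hno)] at h1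
    exact hvP ((hf0 _).1 h1)
  obtain ⟨j, hj⟩ := hj
  set L := Λ (c.support, j) with hLdef
  have hL : Pres B L := hΛ _
  have hLj : L j ∉ P := hΛP (c.support, j)
  have hLi : ∀ i ∈ c.support, i ≠ j → L i ∈ P := hΛ0 (c.support, j)
  have e1 : f (L v) = c j * f (L j) := by
    rw [hexp L hL]
    refine Finset.sum_eq_single_of_mem j hj fun i hi hij => ?_
    rw [(hf0 _).2 (hLi i hi hij), mul_zero]
  have e2 : ∀ x, f (B x (L v)) = c j * f (B x (L j)) := by
    intro x
    have := hexp ((adMap B hB x).comp L) (fun J hJ a ha => hJ x _ (hL J hJ a ha))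
    refine this.trans (Finset.sum_eq_single_of_mem j hj fun i hi hij => ?_)
    have h3 : ((adMap B hB x).comp L) i ∈ P := hpoisson x _ (hLi i hi hij)
    rw [(hf0 _).2 h3, mul_zero]
  have hLv : L v ∉ P := by
    rw [← hf0, e1]
    exact mul_ne_zero (Finsupp.mem_support_iff.1 hj) (fun h => hLj ((hf0 _).1 h))
  obtain ⟨n, -, d, hd, hsum⟩ := hrat (L v) (L j) hLj (fun x => by
    rw [← hf0, map_sub, map_mul, map_mul, e1, e2]; ring)
  exact hXM _ ⟨(c.support, j), rfl⟩
    (mem_of_algebraic P M hprime hM.isPrime hPM (L v) (L j) hLv (hIM (hL I hI v hv)) n d hd hsum)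
end

section
/- Let k be a field and let A be a Poisson algebra over k whose underlying k-vector space has countable (i.e. at most countably infinite) dimension, and assume A satisfies the ACC on radical Poisson ideals. Let P be a prime Poisson ideal of A that is Poisson-rational (for all a, b ∈ A with b ∉ P: if b·{x, a} − a·{x, b} ∈ P for every x ∈ A, then there exist n ≥ 1 and scalars c₀, …, c_n ∈ k, not all zero, with Σ_{i=0}^{n} c_i·a^i·b^{n−i} ∈ P). Then the set of prime Poisson ideals of Poisson-height one over P, i.e. the set of prime Poisson ideals Q with P ⊊ Q such that there is no prime Poisson ideal Q' with P ⊊ Q' ⊊ Q, is at most countable. -/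
namespace PoissonAux

/-- Differential operators generated by multiplications and Hamiltonian derivations. -/
inductive Op {A : Type*} [CommRing A] (B : A → A → A) : (A → A) → Prop
  | id : Op B (fun y => y)
  | smul (a : A) (D : A → A) : Op B D → Op B (fun y => a * D y)
  | add (D E : A → A) : Op B D → Op B E → Op B (fun y => D y + E y)
  | br (x : A) (D : A → A) : Op B D → Op B (fun y => B x (D y))

section
variable {k A : Type*} [Field k] [CommRing A] [Algebra k A] {B : A → A → A}

theorem br_add (hB : IsPoissonBracket k B) (x a b : A) : B x (a + b) = B x a + B x b := by
  obtain ⟨h1, h2, h3, h4, h5⟩ := hB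
  rw [h3 x (a + b), h1, h3 x a, h3 x b]; ring

theorem br_smul (hB : IsPoissonBracket k B) (x : A) (r : k) (a : A) :
    B x (r • a) = r • B x a := by
  obtain ⟨h1, h2, h3, h4, h5⟩ := hB
  rw [h3 x (r • a), h2, h3 x a, smul_neg]

theorem br_mul (hB : IsPoissonBracket k B) (x a b : A) : B x (a * b) = B x a * b + a * B x b :=
  hB.2.2.2.2 x a b

theorem br_zero (hB : IsPoissonBracket k B) (x : A) : B x 0 = 0 := by
  have := br_add hB x 0 0
  simpa using this

theorem br_sum (hB : IsPoissonBracket k B) (x : A) (S : Finset A) (f : A → A) :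
    B x (∑ s ∈ S, f s) = ∑ s ∈ S, B x (f s) := by
  classical
  induction S using Finset.induction_on with
  | empty => simp [br_zero hB]
  | insert a S ha ih => rw [Finset.sum_insert ha, Finset.sum_insert ha, br_add hB, ih]

theorem Op.map_add (hB : IsPoissonBracket k B) {D : A → A} (hD : Op B D) (a b : A) :
    D (a + b) = D a + D b := by
  induction hD with
  | id => rfl
  | smul c D _ ih => simp only [ih]; ring
  | add D E _ _ ih ih' => simp only [ih, ih']; ring
  | br x D _ ih => simp only [ih, br_add hB]

theorem Op.map_smul (hB : IsPoissonBracket k B) {D : A → A} (hD : Op B D) (r : k) (a : A) :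
    D (r • a) = r • D a := by
  induction hD with
  | id => rfl
  | smul c D _ ih => simp only [ih, mul_smul_comm]
  | add D E _ _ ih ih' => simp only [ih, ih', smul_add]
  | br x D _ ih => simp only [ih, br_smul hB]

theorem Op.mem {D : A → A} (hD : Op B D) {Q : Ideal A} (hQ : IsPoissonIdeal B Q) {a : A}
    (ha : a ∈ Q) : D a ∈ Q := by
  induction hD with
  | id => exact ha
  | smul c D _ ih => exact Q.mul_mem_left _ ih
  | add D E _ _ ih ih' => exact Q.add_mem ih ih'
  | br x D _ ih => exact hQ x _ ih

theorem Op.sub {D E : A → A} (hD : Op B D) (hE : Op B E) : Op B (fun y => D y - E y) := by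
  have := Op.add _ _ hD (Op.smul (-1) _ hE)
  simpa [sub_eq_add_neg] using this

theorem Op.sum (S : Finset A) (c : A → A) (T : A → A → A) (hT : ∀ s ∈ S, Op B (T s)) :
    Op B (fun y => ∑ s ∈ S, c s * T s y) := by
  classical
  induction S using Finset.induction_on with
  | empty =>
    have := Op.smul (0 : A) _ (Op.id (B := B))
    simpa using this
  | insert a S ha ih =>
    have h := Op.add _ _ (Op.smul (c a) _ (hT a (by simp)))
      (ih (fun s hs => hT s (Finset.mem_insert_of_mem hs)))
    simpa [Finset.sum_insert ha] using h

/-- The elimination step. -/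
theorem elim (P : Ideal A) (hP : P.IsPrime) (U : Finset A) :
    ∃ (S : Finset A) (g : A) (T : A → A → A), g ∉ P ∧ (∀ s ∈ S, Op B (T s)) ∧
      (∀ s ∈ S, Ideal.Quotient.mk P (T s s) = Ideal.Quotient.mk P g) ∧
      (∀ s ∈ S, ∀ t ∈ S, t ≠ s → Ideal.Quotient.mk P (T s t) = 0) ∧
      (∀ u ∈ U, ∀ D, Op B D → Ideal.Quotient.mk P g * Ideal.Quotient.mk P (D u) =
        ∑ s ∈ S, Ideal.Quotient.mk P (T s u) * Ideal.Quotient.mk P (D s)) := by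
  classical
  induction U using Finset.induction_on with
  | empty =>
    exact ⟨∅, 1, fun _ y => y, fun h => hP.ne_top ((Ideal.eq_top_iff_one P).2 h),
      by simp, by simp, by simp, by simp⟩
  | insert u U hu ih =>
    obtain ⟨S, g, T, hg, hT, h1, h2, h3⟩ := ih
    by_cases hc : ∀ D, Op B D → Ideal.Quotient.mk P g * Ideal.Quotient.mk P (D u) =
        ∑ s ∈ S, Ideal.Quotient.mk P (T s u) * Ideal.Quotient.mk P (D s)
    · refine ⟨S, g, T, hg, hT, h1, h2, ?_⟩
      intro f hf D hD
      rcases Finset.mem_insert.1 hf with rfl | hf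
      · exact hc D hD
      · exact h3 f hf D hD
    · push Not at hc
      obtain ⟨D0, hD0, hne⟩ := hc
      set R : A → A := fun y => g * D0 y - ∑ s ∈ S, D0 s * T s y with hR
      have hRop : Op B R := Op.sub (Op.smul g _ hD0) (Op.sum S D0 T hT)
      have hRmk : ∀ y, Ideal.Quotient.mk P (R y) =
          Ideal.Quotient.mk P g * Ideal.Quotient.mk P (D0 y) -
            ∑ s ∈ S, Ideal.Quotient.mk P (T s y) * Ideal.Quotient.mk P (D0 s) := by
        intro y
        simp only [hR, map_sub, map_mul, map_sum]
        congr 1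
        exact Finset.sum_congr rfl fun s _ => mul_comm _ _
      have hRU : ∀ f ∈ U, Ideal.Quotient.mk P (R f) = 0 := by
        intro f hf
        rw [hRmk, h3 f hf D0 hD0, sub_self]
      have hRS : ∀ t ∈ S, Ideal.Quotient.mk P (R t) = 0 := by
        intro t ht
        rw [hRmk, Finset.sum_eq_single t, h1 t ht, sub_self]
        · intro s hs hst
          rw [h2 s hs t ht hst.symm, zero_mul]
        · exact fun h => absurd ht h
      have hRu : Ideal.Quotient.mk P (R u) ≠ 0 := by
        rw [hRmk]; exact sub_ne_zero.2 hne
      have huS : u ∉ S := fun h => hRu (hRS u h)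
      have hsu : ∀ s ∈ S, s ≠ u := fun s hs h => huS (h ▸ hs)
      refine ⟨insert u S, R u * g,
        fun s => if s = u then (fun y => g * R y) else (fun y => R u * T s y - T s u * R y),
        ?_, ?_, ?_, ?_, ?_⟩
      · intro h
        rcases hP.mem_or_mem h with h | h
        · exact hRu (Ideal.Quotient.eq_zero_iff_mem.2 h)
        · exact hg h
      · intro s hs
        rcases Finset.mem_insert.1 hs with rfl | hs
        · simpa using Op.smul g _ hRop
        · simpa [hsu s hs] using Op.sub (Op.smul (R u) _ (hT s hs)) (Op.smul (T s u) _ hRop)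
      · intro s hs
        rcases Finset.mem_insert.1 hs with rfl | hs
        · simp [mul_comm]
        · simp [hsu s hs, hRS s hs, h1 s hs]
      · intro s hs0 t ht hts
        rcases Finset.mem_insert.1 hs0 with rfl | hs
        · rcases Finset.mem_insert.1 ht with rfl | ht
          · exact absurd rfl hts
          · simp [hRS t ht]
        · have hs' := hsu _ hs
          have h2' := h2 s hs
          clear hs
          rcases Finset.mem_insert.1 ht with rfl | ht
          · simp only [hs', if_false, map_sub, map_mul]; ring
          · simp [hs', hRS t ht, h2' t ht hts]
      · intro f hf D hD
        rw [Finset.sum_insert huS]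
        rcases Finset.mem_insert.1 hf with rfl | hf
        · rw [Finset.sum_eq_zero]
          · simp only [if_true, map_mul]; ring
          · intro s hs
            simp only [hsu s hs, if_false, map_sub, map_mul]; ring
        · simp only [if_true, map_mul, hRU f hf, mul_zero, zero_mul, zero_add]
          rw [mul_assoc, h3 f hf D hD, Finset.mul_sum]
          refine Finset.sum_congr rfl fun s hs => ?_
          simp only [hsu s hs, if_false, map_sub, map_mul, hRU f hf]; ring

theorem key (hB : IsPoissonBracket k B) (P : Ideal A) (hP : P.IsPrime)
    (hpoisson : IsPoissonIdeal B P) (hrat : PoissonRational k B P) (U : Finset A) :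
    ∃ g : A, g ∉ P ∧ ∀ Q : Ideal A, IsPoissonIdeal B Q → Q.IsPrime → P ≤ Q → g ∉ Q →
      ∀ f ∈ Submodule.span k (U : Set A), f ∈ Q → f ∈ P := by
  obtain ⟨S, g, T, hg, hT, h1, h2, h3⟩ := elim (B := B) P hP U
  refine ⟨g, hg, fun Q hQp hQ hPQ hgQ f hf hfQ => ?_⟩
  have hgmk : Ideal.Quotient.mk P g ≠ 0 := fun h => hg (Ideal.Quotient.eq_zero_iff_mem.1 h)
  -- the relation extends to the span
  have hrel : ∀ D, Op B D → Ideal.Quotient.mk P g * Ideal.Quotient.mk P (D f) =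
        ∑ s ∈ S, Ideal.Quotient.mk P (T s f) * Ideal.Quotient.mk P (D s) := by
    intro D hD
    clear hfQ
    induction hf using Submodule.span_induction with
    | mem u hu => exact h3 u hu D hD
    | zero =>
      have h0 : ∀ {E : A → A}, Op B E → E 0 = 0 := by
        intro E hE
        simpa using hE.map_smul hB (0 : k) 0
      rw [h0 hD, Finset.sum_eq_zero]
      · simp
      · intro s hs; rw [h0 (hT s hs)]; simp
    | add a b _ _ iha ihb =>
      rw [hD.map_add hB, map_add, mul_add, iha, ihb, ← Finset.sum_add_distrib]
      refine Finset.sum_congr rfl fun s hs => ?_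
      rw [(hT s hs).map_add hB, map_add, add_mul]
    | smul r a _ ih =>
      rw [hD.map_smul hB, Algebra.smul_def, map_mul, mul_left_comm, ih, Finset.mul_sum]
      refine Finset.sum_congr rfl fun s hs => ?_
      rw [(hT s hs).map_smul hB, Algebra.smul_def, map_mul, mul_assoc]
  have hcentral : ∀ s ∈ S, ∀ x, g * B x (T s f) - T s f * B x g ∈ P := by
    intro s0 hs0 x
    have hD := hT s0 hs0
    have e1 := hrel _ hD
    have e2 := hrel _ (Op.br x _ hD)
    have e3 : Ideal.Quotient.mk P (B x (g * T s0 f - ∑ s ∈ S, T s f * T s0 s)) = 0 := by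
      refine Ideal.Quotient.eq_zero_iff_mem.2 (hpoisson x _ (Ideal.Quotient.eq_zero_iff_mem.1 ?_))
      simp only [map_sub, map_mul, map_sum]
      exact sub_eq_zero.2 e1
    have hneg : ∀ y : A, B x (-y) = - B x y := by
      intro y
      have := br_smul hB x (-1 : k) y
      simpa using this
    rw [sub_eq_add_neg, br_add hB, hneg, br_sum hB, br_mul hB] at e3
    simp only [br_mul hB, Finset.sum_add_distrib, map_add, map_neg, map_sum, map_mul] at e3
    rw [← e2] at e3
    rw [Finset.sum_eq_single s0] at e1
    · rw [Finset.sum_eq_single s0] at e3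
      · rw [h1 s0 hs0] at e1 e3
        have hmul : Ideal.Quotient.mk P g * Ideal.Quotient.mk P
            (g * B x (T s0 f) - T s0 f * B x g) = 0 := by
          simp only [map_sub, map_mul]
          linear_combination (-Ideal.Quotient.mk P g) * e3
        exact Ideal.Quotient.eq_zero_iff_mem.1 ((mul_eq_zero.1 hmul).resolve_left hgmk)
      · intro t ht hts
        rw [h2 s0 hs0 t ht hts, mul_zero]
      · exact fun h => absurd hs0 h
    · intro t ht hts
      rw [h2 s0 hs0 t ht hts, mul_zero]
    · exact fun h => absurd hs0 h
  have hzero : ∀ s ∈ S, T s f ∈ P := by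
    intro s hs
    by_contra hnot
    obtain ⟨n, hn, c, ⟨i, hi, hci⟩, hsum⟩ := hrat (T s f) g hg (hcentral s hs)
    have haQ : T s f ∈ Q := (hT s hs).mem hQp hfQ
    generalize T s f = a at *
    classical
    have hex : ∃ m, m ≤ n ∧ c m ≠ 0 := ⟨i, hi, hci⟩
    set m := Nat.find hex with hm
    obtain ⟨hmn, hcm⟩ := Nat.find_spec hex
    have hlow : ∀ j, j < m → c j = 0 := by
      intro j hj
      by_contra hcj
      exact Nat.find_min hex hj ⟨le_trans hj.le hmn, hcj⟩
    have hfac : ∑ i ∈ Finset.range (n + 1), c i • (a ^ i * g ^ (n - i)) =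
        a ^ m * (c m • g ^ (n - m) +
          a * ∑ i ∈ Finset.Ico (m + 1) (n + 1), c i • (a ^ (i - m - 1) * g ^ (n - i))) := by
      rw [Finset.range_eq_Ico, ← Finset.sum_Ico_consecutive _ (Nat.zero_le m) (by omega : m ≤ n + 1),
        Finset.sum_eq_zero, zero_add, Finset.sum_eq_sum_Ico_succ_bot (by omega), mul_add,
        Finset.mul_sum, Finset.mul_sum]
      · congr 1
        · rw [mul_smul_comm]
        · refine Finset.sum_congr rfl fun j hj => ?_
          have hj' := Finset.mem_Ico.1 hj
          have : a ^ j = a ^ m * (a * a ^ (j - m - 1)) := by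
            rw [← pow_succ', ← pow_add]; congr 1; omega
          rw [mul_smul_comm, mul_smul_comm, this]
          simp only [mul_assoc]
      · intro j hj
        rw [hlow j (Finset.mem_Ico.1 hj).2, zero_smul]
    rw [hfac] at hsum
    have h' := (hP.mem_or_mem hsum).resolve_left (fun h => hnot (hP.mem_of_pow_mem _ h))
    have h'' : c m • g ^ (n - m) ∈ Q :=
      (Q.add_mem_iff_left (Q.mul_mem_right _ haQ)).1 (hPQ h')
    have h3' : g ^ (n - m) ∈ Q := by
      have := Q.mul_mem_left (algebraMap k A (c m)⁻¹) h''
      rwa [← Algebra.smul_def, smul_smul, inv_mul_cancel₀ hcm, one_smul] at this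
    exact hgQ (hQ.mem_of_pow_mem _ h3')
  have hfin := hrel _ Op.id
  rw [Finset.sum_eq_zero] at hfin
  · exact Ideal.Quotient.eq_zero_iff_mem.1 ((mul_eq_zero.1 hfin).resolve_left hgmk)
  · intro s hs
    rw [Ideal.Quotient.eq_zero_iff_mem.2 (hzero s hs), zero_mul]

/-- Colon ideal by a set. -/
def col (I : Ideal A) (X : Set A) : Ideal A where
  carrier := {y | ∀ x ∈ X, y * x ∈ I}
  add_mem' := by
    intro a b ha hb x hx
    rw [add_mul]; exact I.add_mem (ha x hx) (hb x hx)
  zero_mem' := by intro x _; simp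
  smul_mem' := by
    intro c y hy x hx
    rw [smul_eq_mul, mul_assoc]; exact I.mul_mem_left _ (hy x hx)

theorem le_col (I : Ideal A) (X : Set A) : I ≤ col I X := fun _ hy x _ => I.mul_mem_right x hy

theorem col_radical {I : Ideal A} (hI : I.IsRadical) (X : Set A) : (col I X).IsRadical := by
  rintro y ⟨n, hn⟩ x hx
  refine hI ⟨n + 1, ?_⟩
  have h := I.mul_mem_left (y * x ^ n) (hn x hx)
  have e : (y * x) ^ (n + 1) = y * x ^ n * (y ^ n * x) := by ring
  rw [e]; exact h

theorem col_poisson (hB : IsPoissonBracket k B) {I : Ideal A} (hI : I.IsRadical)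
    (hp : IsPoissonIdeal B I) (X : Set A) : IsPoissonIdeal B (col I X) := by
  intro z y hy x hx
  have h := hp z _ (hy x hx)
  rw [br_mul hB] at h
  refine hI ⟨2, ?_⟩
  have h1 := I.mul_mem_left (B z y * x) h
  have h2 := I.mul_mem_left (B z y * B z x) (hy x hx)
  have e : (B z y * x) ^ 2 = (B z y * x) * (B z y * x + y * B z x) - B z y * B z x * (y * x) := by
    ring
  rw [e]; exact I.sub_mem h1 h2

theorem finite_primes (hB : IsPoissonBracket k B) (hacc : PoissonRadicalACC B)
    (I : Ideal A) (hp : IsPoissonIdeal B I) (hr : I.IsRadical) :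
    ∃ F : Set (Ideal A), F.Finite ∧ (∀ R ∈ F, IsPoissonIdeal B R ∧ R.IsPrime ∧ I ≤ R) ∧
      ∀ Q : Ideal A, Q.IsPrime → I ≤ Q → ∃ R ∈ F, R ≤ Q := by
  let X := {I : Ideal A // IsPoissonIdeal B I ∧ I.IsRadical}
  have wf : WellFoundedGT X := by
    rw [wellFoundedGT_iff_monotone_chain_condition]
    intro c
    obtain ⟨N, hN⟩ := hacc (fun n => (c n).1) (fun n => (c n).2.1) (fun n => (c n).2.2)
      (fun i j hij => c.monotone hij)
    exact ⟨N, fun m hm => Subtype.ext (hN m hm).symm⟩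
  suffices H : ∀ J : X, ∃ F : Set (Ideal A), F.Finite ∧
      (∀ R ∈ F, IsPoissonIdeal B R ∧ R.IsPrime ∧ J.1 ≤ R) ∧
      ∀ Q : Ideal A, Q.IsPrime → J.1 ≤ Q → ∃ R ∈ F, R ≤ Q from H ⟨I, hp, hr⟩
  intro J
  induction J using WellFoundedGT.induction with
  | ind J ih =>
  obtain ⟨I, hp, hr⟩ := J
  by_cases htop : I = ⊤
  · refine ⟨∅, Set.finite_empty, by simp, fun Q hQ h => ?_⟩
    exact absurd (top_le_iff.1 (htop ▸ h)) hQ.ne_top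
  by_cases hpr : I.IsPrime
  · exact ⟨{I}, Set.finite_singleton _, by simp [hp, hpr], fun Q _ h => ⟨I, rfl, h⟩⟩
  have hab : ∃ a b, a * b ∈ I ∧ a ∉ I ∧ b ∉ I := by
    by_contra hcon
    push Not at hcon
    exact hpr ⟨htop, fun {a b} h => by
      by_cases ha : a ∈ I
      · exact Or.inl ha
      · exact Or.inr (hcon a b h ha)⟩
  obtain ⟨a, b, hab, ha, hb⟩ := hab
  let J1 := col I {a}
  let J2 := col I (J1 : Set A)
  have hb1 : b ∈ J1 := by
    rintro x rfl
    rwa [mul_comm]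
  have ha2 : a ∈ J2 := by
    intro x hx
    rw [mul_comm]; exact hx a rfl
  obtain ⟨F1, hF1, hF1', hF1''⟩ := ih ⟨J1, col_poisson hB hr hp _, col_radical hr _⟩
    (lt_of_le_of_ne (show I ≤ J1 from le_col I _) fun h => by
      have : I = J1 := congrArg Subtype.val h
      exact hb (this ▸ hb1))
  obtain ⟨F2, hF2, hF2', hF2''⟩ := ih ⟨J2, col_poisson hB hr hp _, col_radical hr _⟩
    (lt_of_le_of_ne (show I ≤ J2 from le_col I _) fun h => by
      have : I = J2 := congrArg Subtype.val h
      exact ha (this ▸ ha2))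
  refine ⟨F1 ∪ F2, hF1.union hF2, ?_, ?_⟩
  · rintro R (hR | hR)
    · exact ⟨(hF1' R hR).1, (hF1' R hR).2.1, (le_col I _).trans (hF1' R hR).2.2⟩
    · exact ⟨(hF2' R hR).1, (hF2' R hR).2.1, (le_col I _).trans (hF2' R hR).2.2⟩
  · intro Q hQ hIQ
    by_cases h1 : J1 ≤ Q
    · obtain ⟨R, hR, h⟩ := hF1'' Q hQ h1
      exact ⟨R, Or.inl hR, h⟩
    · obtain ⟨y, hy, hyQ⟩ := Set.not_subset.1 h1
      have h2 : J2 ≤ Q := fun z hz => (hQ.mem_or_mem (hIQ (hz y hy))).resolve_right hyQ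
      obtain ⟨R, hR, h⟩ := hF2'' Q hQ h2
      exact ⟨R, Or.inr hR, h⟩

theorem finite_height_one (hB : IsPoissonBracket k B) (hacc : PoissonRadicalACC B)
    (P : Ideal A) (g : A) (hg : g ∉ P) :
    Set.Finite {Q : Ideal A | (IsPoissonIdeal B Q ∧ Q.IsPrime ∧ P < Q ∧
      ¬ ∃ R : Ideal A, IsPoissonIdeal B R ∧ R.IsPrime ∧ P < R ∧ R < Q) ∧ g ∈ Q} := by
  let Y : Set (Ideal A) := {J | IsPoissonIdeal B J ∧ J.IsRadical ∧ P ≤ J ∧ g ∈ J}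
  obtain ⟨F, hF, hF1, hF2⟩ := finite_primes hB hacc (sInf Y)
    (fun x y hy => by
      rw [Submodule.mem_sInf] at hy ⊢
      exact fun J hJ => hJ.1 x y (hy J hJ))
    (by
      rintro y ⟨n, hn⟩
      rw [Submodule.mem_sInf] at hn ⊢
      exact fun J hJ => hJ.2.1 ⟨n, hn J hJ⟩)
  refine hF.subset ?_
  rintro Q ⟨⟨hQp, hQ, hPQ, hmin⟩, hgQ⟩
  obtain ⟨R, hR, hRQ⟩ := hF2 Q hQ (sInf_le ⟨hQp, hQ.isRadical, hPQ.le, hgQ⟩)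
  obtain ⟨hRp, hRpr, hle⟩ := hF1 R hR
  have hPR : P ≤ R := (le_sInf fun J hJ => hJ.2.2.1).trans hle
  have hgR : g ∈ R := hle (by rw [Submodule.mem_sInf]; exact fun J hJ => hJ.2.2.2)
  have hlt : P < R := lt_of_le_of_ne hPR fun h => hg (h ▸ hgR)
  rcases hRQ.lt_or_eq with h | h
  · exact absurd ⟨R, hRp, hRpr, hlt, h⟩ hmin
  · exact h ▸ hR

end

end PoissonAux

/-- Let `A` be a Poisson algebra over a field `k` of countable vector
space dimension satisfying the ACC on radical Poisson ideals.  If `P` is a Poisson-rational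
prime Poisson ideal of `A`, then the set of prime Poisson ideals of Poisson-height one over
`P` (those `Q ⊋ P` with no prime Poisson ideal strictly between `P` and `Q`) is at most
countable. -/
theorem countable_poisson_height_one_of_poissonRational
    {k A : Type*} [Field k] [CommRing A] [Algebra k A]
    (hdim : CountableDimension k A)
    (B : A → A → A) (hB : IsPoissonBracket k B)
    (hacc : PoissonRadicalACC B)
    (P : Ideal A) (hprime : P.IsPrime) (hpoisson : IsPoissonIdeal B P)
    (hrat : PoissonRational k B P) :
    Set.Countable {Q : Ideal A | IsPoissonIdeal B Q ∧ Q.IsPrime ∧ P < Q ∧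
      ¬ ∃ R : Ideal A, IsPoissonIdeal B R ∧ R.IsPrime ∧ P < R ∧ R < Q} := by
  obtain ⟨E, hE, hspan⟩ := hdim
  have : Countable E := hE.to_subtype
  choose g hg hgQ using fun U : Finset A =>
    PoissonAux.key hB P hprime hpoisson hrat U
  classical
  refine Set.Countable.mono (s₂ := ⋃ U : Finset E, {Q : Ideal A | (IsPoissonIdeal B Q ∧
      Q.IsPrime ∧ P < Q ∧
      ¬ ∃ R : Ideal A, IsPoissonIdeal B R ∧ R.IsPrime ∧ P < R ∧ R < Q) ∧
        g (U.image Subtype.val) ∈ Q}) ?_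
    (Set.countable_iUnion fun U =>
      (PoissonAux.finite_height_one hB hacc P _ (hg _)).countable)
  intro Q hQ
  obtain ⟨f, hfQ, hfP⟩ := Set.exists_of_ssubset (show (P : Set A) ⊂ Q from hQ.2.2.1)
  have hf : f ∈ Submodule.span k E := hspan ▸ Submodule.mem_top
  obtain ⟨V, hV, hfV⟩ := Submodule.mem_span_finite_of_mem_span hf
  refine Set.mem_iUnion.2 ⟨V.subtype (· ∈ E), hQ, ?_⟩
  have hVe : (V.subtype (· ∈ E)).image Subtype.val = V := by
    ext x
    simp only [Finset.mem_image, Finset.mem_subtype]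
    constructor
    · rintro ⟨y, hy, rfl⟩; exact hy
    · intro hx; exact ⟨⟨x, hV hx⟩, hx, rfl⟩
  rw [hVe]
  by_contra hgn
  exact hfP (hgQ V Q hQ.1 hQ.2.1 hQ.2.2.1.le hgn f hfV hfQ)
end

section
/- Let k be a field of characteristic zero and let A = k[x₁, x₂, x₃, …] be the polynomial algebra in countably many variables x_i indexed by the positive integers (the symmetric algebra of the positive Witt algebra W₊), equipped with a bracket {-,-} : A × A → A that is k-bilinear, antisymmetric, satisfies the Jacobi identity, is a derivation in each argument, and satisfies {x_i, x_j} = (j − i)·x_{i+j} for all i, j ≥ 1. Then: (a) the zero ideal is Poisson-rational, and in fact the Poisson centre of the fraction field of A is k, i.e. whenever f, g ∈ A are nonzero and satisfy g·{x, f} = f·{x, g} for all x ∈ A, there exists c ∈ k with f = c·g; and (b) the zero ideal is not Poisson-locally closed, i.e. the intersection of all nonzero prime Poisson ideals of A is the zero ideal. -/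
open MvPolynomial

namespace WittPlusProof

variable {k : Type*} [Field k]

/-- coefficients of the Euler-type operator -/
lemma coeff_X_mul_pderiv {σ : Type*} (i : σ) (p : MvPolynomial σ k) (d : σ →₀ ℕ) :
    coeff d (X i * pderiv i p) = d i * coeff d p := by
  classical
  induction p using MvPolynomial.induction_on' with
  | add p q hp hq => simp only [map_add, mul_add, coeff_add, hp, hq]
  | monomial n a =>
    rw [X_mul_pderiv_monomial, coeff_smul, coeff_monomial]
    split_ifs with h
    · subst h; simp
    · simp

lemma degree_eq [CharZero k] {σ : Type*} (m : MonomialOrder σ) (f g : MvPolynomial σ k)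
    (hf : f ≠ 0) (hg : g ≠ 0) (h : ∀ i, g * pderiv i f = f * pderiv i g) :
    m.degree f = m.degree g := by
  ext i
  have hle : ∀ p : MvPolynomial σ k, m.toSyn (m.degree (X i * pderiv i p)) ≤
      m.toSyn (m.degree p) := by
    intro p
    rw [m.degree_le_iff]
    intro b hb
    apply m.le_degree
    rw [mem_support_iff, coeff_X_mul_pderiv] at hb
    rw [mem_support_iff]
    exact right_ne_zero_of_mul hb
  have h1 : g * (X i * pderiv i f) = (X i * pderiv i g) * f := by
    linear_combination X i * h i
  have h2 := congrArg (coeff (m.degree g + m.degree f)) h1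
  rw [m.coeff_mul_of_add_of_degree_le le_rfl (hle f),
    m.coeff_mul_of_add_of_degree_le (hle g) le_rfl, coeff_X_mul_pderiv, coeff_X_mul_pderiv] at h2
  have hf' := (m.coeff_degree_ne_zero_iff).2 hf
  have hg' := (m.coeff_degree_ne_zero_iff).2 hg
  have h3 : (coeff (m.degree g) g * coeff (m.degree f) f) *
      (((m.degree f) i : k) - ((m.degree g) i : k)) = 0 := by
    linear_combination h2
  have h4 := (mul_eq_zero.1 h3).resolve_left (mul_ne_zero hg' hf')
  exact_mod_cast sub_eq_zero.1 h4

lemma eq_smul [CharZero k] {σ : Type*} (m : MonomialOrder σ) (f g : MvPolynomial σ k)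
    (hg : g ≠ 0) (h : ∀ i, g * pderiv i f = f * pderiv i g) :
    ∃ c : k, f = c • g := by
  have hg' := (m.coeff_degree_ne_zero_iff).2 hg
  refine ⟨coeff (m.degree g) f / coeff (m.degree g) g, ?_⟩
  set c := coeff (m.degree g) f / coeff (m.degree g) g with hc
  by_contra hne
  have hne' : f - c • g ≠ 0 := sub_ne_zero.2 hne
  have h1 := degree_eq m (f - c • g) g hne' hg (by
    intro i
    rw [map_sub, Derivation.map_smul, mul_sub, sub_mul, h i, mul_smul_comm, smul_mul_assoc])
  have h2 := (m.coeff_degree_ne_zero_iff).2 hne'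
  rw [h1] at h2
  apply h2
  rw [coeff_sub, coeff_smul, smul_eq_mul, hc, div_mul_cancel₀ _ hg', sub_self]

/-- a monomial order on the monomials in variables indexed by positive integers -/
noncomputable def pnatOrder : MonomialOrder ℕ+ := (MonomialOrder.lex (σ := ℕ+ᵒᵈ))

/-- The derivation `B x`. -/
noncomputable def der (B : MvPolynomial ℕ+ k → MvPolynomial ℕ+ k → MvPolynomial ℕ+ k)
    (hB : IsPoissonBracket k B) (x : MvPolynomial ℕ+ k) :
    Derivation k (MvPolynomial ℕ+ k) (MvPolynomial ℕ+ k) :=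
  Derivation.mk'
    { toFun := B x
      map_add' := by
        intro a b
        rw [hB.2.2.1 x, hB.1, hB.2.2.1 x a, hB.2.2.1 x b, neg_add]
      map_smul' := by
        intro r a
        rw [hB.2.2.1 x, hB.2.1, hB.2.2.1 x a, RingHom.id_apply, smul_neg] }
    (by
      intro a b
      simp only [LinearMap.coe_mk, AddHom.coe_mk, smul_eq_mul]
      rw [hB.2.2.2.2]; ring)

lemma der_apply (B : MvPolynomial ℕ+ k → MvPolynomial ℕ+ k → MvPolynomial ℕ+ k)
    (hB : IsPoissonBracket k B) (x y : MvPolynomial ℕ+ k) : der B hB x y = B x y := rfl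

lemma commutator (B : MvPolynomial ℕ+ k → MvPolynomial ℕ+ k → MvPolynomial ℕ+ k)
    (hB : IsPoissonBracket k B)
    (hgen : ∀ i j : ℕ+,
      B (X i) (X j) = (((j : ℕ) : ℤ) - ((i : ℕ) : ℤ)) • (X (i + j) : MvPolynomial ℕ+ k))
    (m l : ℕ+) :
    ⁅pderiv (R := k) (m + l), der B hB (X m)⁆ = (((l : ℕ) : k) - ((m : ℕ) : k)) • pderiv l := by
  classical
  apply derivation_ext
  intro j
  rw [Derivation.commutator_apply, der_apply, der_apply, hgen, Derivation.smul_apply]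
  have h0 : B (X m) (pderiv (m + l) (X j : MvPolynomial ℕ+ k)) = 0 := by
    rw [← der_apply B hB, pderiv_X, Pi.single_apply]
    split_ifs
    · exact Derivation.map_one_eq_zero _
    · exact map_zero _
  rw [h0, sub_zero, map_zsmul]
  by_cases h : j = l
  · subst h
    simp only [pderiv_X_self]
    rw [← Int.cast_smul_eq_zsmul k]
    push_cast
    rfl
  · rw [pderiv_X_of_ne (by simpa using h), pderiv_X_of_ne h, smul_zero, smul_zero]

lemma rational [CharZero k] (B : MvPolynomial ℕ+ k → MvPolynomial ℕ+ k → MvPolynomial ℕ+ k)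
    (hB : IsPoissonBracket k B)
    (hgen : ∀ i j : ℕ+,
      B (X i) (X j) = (((j : ℕ) : ℤ) - ((i : ℕ) : ℤ)) • (X (i + j) : MvPolynomial ℕ+ k))
    (f g : MvPolynomial ℕ+ k) (hg : g ≠ 0)
    (h : ∀ x : MvPolynomial ℕ+ k, g * B x f = f * B x g) : ∃ c : k, f = c • g := by
  classical
  apply eq_smul pnatOrder f g hg
  intro l
  obtain ⟨m, hm⟩ := (f.vars ∪ g.vars ∪ {l}).exists_le
  have hl : l < m + 1 := lt_of_le_of_lt (hm l (by simp)) (PNat.lt_add_right m 1)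
  have hnot : ∀ i ∈ f.vars ∪ g.vars ∪ {l}, i ≠ m + 1 + l := by
    intro i hi
    exact ne_of_lt (lt_of_le_of_lt (hm i hi)
      ((PNat.lt_add_right m 1).trans (PNat.lt_add_right (m + 1) l)))
  have hf0 : pderiv (m + 1 + l) f = 0 := pderiv_eq_zero_of_notMem_vars fun hi =>
    hnot _ (by simp [hi]) rfl
  have hg0 : pderiv (m + 1 + l) g = 0 := pderiv_eq_zero_of_notMem_vars fun hi =>
    hnot _ (by simp [hi]) rfl
  have key : ∀ p : MvPolynomial ℕ+ k, pderiv (m + 1 + l) p = 0 →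
      pderiv (m + 1 + l) (B (X (m + 1)) p) =
        (((l : ℕ) : k) - (((m + 1 : ℕ+) : ℕ) : k)) • pderiv l p := by
    intro p hp
    have := congrArg (fun D => D p) (commutator B hB hgen (m + 1) l)
    simp only [Derivation.commutator_apply, Derivation.smul_apply, hp, map_zero, sub_zero] at this
    exact this
  have h1 := congrArg (pderiv (m + 1 + l)) (h (X (m + 1)))
  rw [pderiv_mul, pderiv_mul, hf0, hg0, key f hf0, key g hg0, zero_mul, zero_mul, zero_add,
    zero_add, mul_smul_comm, mul_smul_comm] at h1
  refine smul_right_injective _ ?_ h1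
  intro h0
  have h2 : (l : ℕ) = ((m + 1 : ℕ+) : ℕ) := by exact_mod_cast sub_eq_zero.1 h0
  exact hl.ne (PNat.coe_injective h2)

/-- The homomorphism `xᵢ ↦ ∑ tₐ^(i+1) yₐ`. -/
noncomputable def phi (k : Type*) [Field k] (n : ℕ) :
    MvPolynomial ℕ+ k →ₐ[k] MvPolynomial (Fin n ⊕ Fin n) k :=
  aeval fun i => ∑ a : Fin n, X (Sum.inl a) ^ ((i : ℕ) + 1) * X (Sum.inr a)

lemma phi_X (n : ℕ) (i : ℕ+) :
    phi k n (X i) = ∑ a : Fin n, X (Sum.inl a) ^ ((i : ℕ) + 1) * X (Sum.inr a) := by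
  simp [phi]

/-- The Hamiltonian derivation of the image of `x_m`. -/
noncomputable def ham (k : Type*) [Field k] (n : ℕ) (m : ℕ) :
    Derivation k (MvPolynomial (Fin n ⊕ Fin n) k) (MvPolynomial (Fin n ⊕ Fin n) k) :=
  mkDerivation k (Sum.elim (fun a => X (Sum.inl a) ^ (m + 1))
    (fun a => -(((m : MvPolynomial (Fin n ⊕ Fin n) k) + 1) * X (Sum.inl a) ^ m * X (Sum.inr a))))

lemma ham_phi (n : ℕ) (m j : ℕ+) :
    ham k n m (phi k n (X j)) = (((j : ℕ) : ℤ) - ((m : ℕ) : ℤ)) • phi k n (X (m + j)) := by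
  rw [phi_X, phi_X, map_sum, Finset.smul_sum]
  refine Finset.sum_congr rfl fun a _ => ?_
  rw [Derivation.leibniz, Derivation.leibniz_pow]
  simp only [ham, mkDerivation_X, Sum.elim_inl, Sum.elim_inr, smul_eq_mul, zsmul_eq_mul,
    nsmul_eq_mul, PNat.add_coe]
  push_cast
  ring

lemma phi_B (B : MvPolynomial ℕ+ k → MvPolynomial ℕ+ k → MvPolynomial ℕ+ k)
    (hB : IsPoissonBracket k B)
    (hgen : ∀ i j : ℕ+,
      B (X i) (X j) = (((j : ℕ) : ℤ) - ((i : ℕ) : ℤ)) • (X (i + j) : MvPolynomial ℕ+ k))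
    (n : ℕ) (m : ℕ+) (f : MvPolynomial ℕ+ k) :
    phi k n (B (X m) f) = ham k n m (phi k n f) := by
  rw [← der_apply B hB]
  induction f using MvPolynomial.induction_on with
  | C a =>
    rw [derivation_C, map_zero, ← algebraMap_eq, AlgHom.commutes, Derivation.map_algebraMap]
  | add p q hp hq => simp only [map_add, hp, hq]
  | mul_X p j hp =>
    rw [Derivation.leibniz, map_mul, Derivation.leibniz, map_add, smul_eq_mul, smul_eq_mul,
      map_mul, map_mul, hp, der_apply, hgen, map_zsmul, ham_phi, smul_eq_mul, smul_eq_mul]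

lemma ker_poisson (B : MvPolynomial ℕ+ k → MvPolynomial ℕ+ k → MvPolynomial ℕ+ k)
    (hB : IsPoissonBracket k B)
    (hgen : ∀ i j : ℕ+,
      B (X i) (X j) = (((j : ℕ) : ℤ) - ((i : ℕ) : ℤ)) • (X (i + j) : MvPolynomial ℕ+ k))
    (n : ℕ) : IsPoissonIdeal B (RingHom.ker (phi k n)) := by
  intro x y hy
  rw [hB.2.2.1, neg_mem_iff, ← der_apply B hB]
  induction x using MvPolynomial.induction_on with
  | C a => rw [derivation_C]; exact zero_mem _
  | add p q hp hq => rw [map_add]; exact add_mem hp hq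
  | mul_X p j hp =>
    rw [Derivation.leibniz, smul_eq_mul, smul_eq_mul]
    refine add_mem (Ideal.mul_mem_left _ _ ?_) (Ideal.mul_mem_left _ _ hp)
    rw [der_apply, hB.2.2.1, neg_mem_iff, RingHom.mem_ker, phi_B B hB hgen, RingHom.mem_ker.1 hy,
      map_zero]

lemma ker_ne_bot (n : ℕ) : RingHom.ker (phi k n) ≠ ⊥ := by
  intro h
  have hinj : Function.Injective (phi k n) := (RingHom.injective_iff_ker_eq_bot _).2 h
  have hai : AlgebraicIndependent k
      (fun i : ℕ+ => ∑ a : Fin n, (X (Sum.inl a) ^ ((i : ℕ) + 1) * X (Sum.inr a) :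
        MvPolynomial (Fin n ⊕ Fin n) k)) := hinj
  have h1 := hai.lift_cardinalMk_le_trdeg
  rw [MvPolynomial.trdeg_of_isDomain] at h1
  simp at h1
  exact absurd h1 (not_le.2 (by exact_mod_cast Cardinal.natCast_lt_aleph0 (n := n + n)))

lemma exists_solution [CharZero k] (n : ℕ) (v : ℕ → k) :
    ∃ t y : Fin n → k, ∀ i : ℕ, 1 ≤ i → i ≤ n → ∑ a, t a ^ (i + 1) * y a = v i := by
  set t : Fin n → k := fun a => ((a : ℕ) : k) + 1 with ht
  have ht0 : ∀ a, t a ≠ 0 := fun a => Nat.cast_add_one_ne_zero _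
  have hti : Function.Injective t := by
    intro a b hab
    have : ((a : ℕ) : k) = ((b : ℕ) : k) := add_right_cancel hab
    exact Fin.ext (by exact_mod_cast this)
  have hdet : IsUnit (Matrix.vandermonde t).det :=
    isUnit_iff_ne_zero.2 (Matrix.det_vandermonde_ne_zero_iff.2 hti)
  have hu : IsUnit (Matrix.vandermonde t).transpose := by
    rw [Matrix.isUnit_iff_isUnit_det, Matrix.det_transpose]; exact hdet
  obtain ⟨z, hz⟩ := (Matrix.mulVec_surjective_iff_isUnit.2 hu) (fun i : Fin n => v ((i : ℕ) + 1))
  refine ⟨t, fun a => z a / t a ^ 2, ?_⟩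
  intro i h1 h2
  have h3 := congrFun hz ⟨i - 1, by omega⟩
  simp only [Matrix.mulVec, dotProduct, Matrix.transpose_apply, Matrix.vandermonde_apply] at h3
  obtain ⟨i, rfl⟩ : ∃ j, i = j + 1 := ⟨i - 1, by omega⟩
  simp only [Nat.add_sub_cancel] at h3
  rw [← h3]
  refine Finset.sum_congr rfl fun a _ => ?_
  have := ht0 a
  field_simp
  ring

lemma exists_phi_ne [CharZero k] (f : MvPolynomial ℕ+ k) (hf : f ≠ 0) :
    ∃ n, phi k n f ≠ 0 := by
  obtain ⟨v, hv⟩ : ∃ v : ℕ+ → k, eval v f ≠ 0 := by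
    by_contra! hcon
    exact hf (MvPolynomial.funext fun v => by rw [hcon v, map_zero])
  obtain ⟨n, hn⟩ := f.vars.exists_le
  refine ⟨n, fun h0 => hv ?_⟩
  obtain ⟨t, y, hty⟩ := exists_solution (k := k) n
    (fun i => if h : 0 < i then v ⟨i, h⟩ else 0)
  have h1 : eval (Sum.elim t y) (phi k n f) = eval v f := by
    have h2 : eval (Sum.elim t y) (phi k n f) =
        eval (fun i : ℕ+ => ∑ a, t a ^ ((i : ℕ) + 1) * y a) f := by
      have h3 : (eval (Sum.elim t y)).comp (phi k n : _ →+* _) =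
          eval (fun i : ℕ+ => ∑ a, t a ^ ((i : ℕ) + 1) * y a) := by
        apply MvPolynomial.ringHom_ext
        · intro r; simp [phi]
        · intro i; simp [phi_X]
      exact congrArg (fun F : MvPolynomial ℕ+ k →+* k => F f) h3
    rw [h2]
    refine eval₂Hom_congr' rfl ?_ rfl
    intro i hi _
    rw [hty i i.pos (hn i hi), dif_pos i.pos]
    rfl
  rw [← h1, h0, map_zero]

end WittPlusProof

/-- Let `k` be a field of characteristic zero and let
`A = k[x₁, x₂, x₃, …]` be the symmetric algebra of the positive Witt algebra, endowed with its
Poisson bracket determined by `{xᵢ, xⱼ} = (j − i)·x_{i+j}`.  Then (a) the zero ideal is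
Poisson-rational and in fact the Poisson centre of `Frac(A)` is `k`: whenever nonzero
`f, g ∈ A` satisfy `g·{x, f} = f·{x, g}` for all `x ∈ A`, `f` is a `k`-multiple of `g`; and
(b) the zero ideal is not Poisson-locally closed: the intersection of all nonzero prime
Poisson ideals of `A` is zero. -/
theorem symmetricAlgebraWittPlus_rational_not_locallyClosed
    {k : Type*} [Field k] [CharZero k]
    (B : MvPolynomial ℕ+ k → MvPolynomial ℕ+ k → MvPolynomial ℕ+ k)
    (hB : IsPoissonBracket k B)
    (hgen : ∀ i j : ℕ+,
      B (X i) (X j) = (((j : ℕ) : ℤ) - ((i : ℕ) : ℤ)) • (X (i + j) : MvPolynomial ℕ+ k)) :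
    (∀ f g : MvPolynomial ℕ+ k, f ≠ 0 → g ≠ 0 →
      (∀ x : MvPolynomial ℕ+ k, g * B x f = f * B x g) → ∃ c : k, f = c • g) ∧
    sInf {P : Ideal (MvPolynomial ℕ+ k) | IsPoissonIdeal B P ∧ P.IsPrime ∧ P ≠ ⊥} = ⊥ := by
  refine ⟨fun f g _ hg h => WittPlusProof.rational B hB hgen f g hg h, ?_⟩
  rw [eq_bot_iff]
  intro f hf
  rw [Ideal.mem_bot]
  by_contra hne
  obtain ⟨n, hn⟩ := WittPlusProof.exists_phi_ne f hne
  apply hn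
  rw [Ideal.mem_sInf] at hf
  exact RingHom.mem_ker.1 (hf (I := RingHom.ker (WittPlusProof.phi k n))
    ⟨WittPlusProof.ker_poisson B hB hgen n, RingHom.ker_isPrime _,
      WittPlusProof.ker_ne_bot n⟩)
end
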